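/- arXiv:1708.08295 — 2 statements merged into one kernel-verified Lean document; each statement's English description precedes it below -/
import Mathlib

section
/- Let f be an analytic function germ at 0 in K^n (K = ℝ or ℂ) with f(0)=0, and let u be a unit in K{z_1,…,z_n} (i.e. u(0) ≠ 0). Then the Łojasiewicz gradient exponents of u·f and of f at the origin are equal: ℒ(u·f) = ℒ(f). -/
open Filter

noncomputable def LGE {𝕜 : Type*} [RCLike 𝕜] {E : Type*} [NormedAddCommGroup E]
    [NormedSpace 𝕜 E] (f : E → 𝕜) : ℝ :=
  sInf {l : ℝ | 0 < l ∧ ∃ c > (0:ℝ), ∃ ε > (0:ℝ), ∀ z : E, ‖z‖ < ε →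
    c * ‖f z‖ ^ l ≤ ‖fderiv 𝕜 f z‖}

open IsLocalRing in
/-- A Noetherian local domain all of whose nonzero primes share a nonzero element has
dimension at most one. -/
theorem krullDimLE_one_of_mem_of_isPrime {S : Type*} [CommRing S] [IsDomain S]
    [IsNoetherianRing S] [IsLocalRing S] {f : S} (hf0 : f ≠ 0)
    (h : ∀ p : Ideal S, p.IsPrime → p ≠ ⊥ → f ∈ p) : Ring.KrullDimLE 1 S := by
  refine Ring.KrullDimLE.mk₁' fun I hI hIp => ?_
  have hfI := h I hIp hI
  have hfm : f ∈ maximalIdeal S := le_maximalIdeal hIp.ne_top hfI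
  suffices hmin : maximalIdeal S ∈ (Ideal.span {f}).minimalPrimes by
    have hle : maximalIdeal S ≤ I := hmin.2 ⟨hIp, by simpa [Ideal.span_le] using hfI⟩
        (le_maximalIdeal hIp.ne_top)
    rw [le_antisymm (le_maximalIdeal hIp.ne_top) hle]
    exact maximalIdeal.isMaximal S
  by_contra hm
  have hcov : ¬ ((maximalIdeal S : Set S) ⊆
      ⋃ p ∈ (Ideal.span {f}).minimalPrimes, (p : Set S)) := by
    intro hsub
    obtain ⟨p, hp, hle⟩ := ((maximalIdeal S).subset_union_prime_finite
      (Ideal.finite_minimalPrimes_of_isNoetherianRing S (Ideal.span {f})) (f := id) 0 0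
      fun _ h _ _ => h.isPrime).1 hsub
    obtain rfl := le_antisymm hle (le_maximalIdeal hp.isPrime.ne_top)
    exact hm hp
  obtain ⟨x, hxm, hx⟩ := Set.not_subset.1 hcov
  simp only [Set.mem_iUnion, SetLike.mem_coe, not_exists] at hx
  obtain ⟨q, hq, -⟩ := Ideal.exists_minimalPrimes_le
    (I := Ideal.span {x}) (J := maximalIdeal S) (by simpa [Ideal.span_le] using hxm)
  have := hq.isPrime
  have hxq : x ∈ q := hq.1.2 (Ideal.mem_span_singleton_self x)
  have hq0 : q ≠ ⊥ := by
    rintro rfl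
    obtain ⟨p, hp, -⟩ := Ideal.exists_minimalPrimes_le
      (I := Ideal.span {f}) (J := maximalIdeal S) (by simpa [Ideal.span_le] using hfm)
    rw [Ideal.mem_bot] at hxq
    exact hx p hp (hxq ▸ p.zero_mem)
  obtain ⟨p, hp, hpq⟩ := Ideal.exists_minimalPrimes_le
    (I := Ideal.span {f}) (J := q) (by simpa [Ideal.span_le] using h q hq.isPrime hq0)
  have := hp.isPrime
  have hlt : p < q := lt_of_le_of_ne hpq fun e => hx p hp (e ▸ hxq)
  have hp0 : ⊥ < p := by
    rw [bot_lt_iff_ne_bot]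
    rintro rfl
    exact hf0 (by simpa using hp.1.2 (Ideal.mem_span_singleton_self f))
  have h1 := Ideal.height_le_one_of_isPrincipal_of_mem_minimalPrimes _ q hq
  have h2 := Ideal.height_add_one_le_of_lt_of_isPrime hlt
  have h3 := Ideal.height_add_one_le_of_lt_of_isPrime hp0
  have h4 : ((2 : ℕ) : ℕ∞) ≤ ((1 : ℕ) : ℕ∞) := by
    calc ((2 : ℕ) : ℕ∞) ≤ (⊥ : Ideal S).height + 1 + 1 := by
          rw [add_assoc]; exact le_add_left (by norm_num)
      _ ≤ p.height + 1 := by gcongr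
      _ ≤ q.height := h2
      _ ≤ _ := by exact_mod_cast h1
  exact absurd (Nat.cast_le.1 h4) (by norm_num)

/-- For a nonzero ideal `I` in a domain, `S ⧸ sI` is an extension of `S ⧸ sS` by `S ⧸ I`. -/
theorem coheight_span_singleton_mul {S : Type*} [CommRing S] [IsDomain S] {s : S} (hs : s ≠ 0)
    (I : Ideal S) :
    Order.coheight (Ideal.span {s} * I) = Order.coheight I + Order.coheight (Ideal.span {s}) := by
  rw [← Module.length_quotient, ← Module.length_quotient, ← Module.length_quotient]
  have hle : I ≤ Submodule.comap (LinearMap.mulLeft S s) (Ideal.span {s} * I) := fun x hx =>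
    Ideal.mul_mem_mul (Ideal.mem_span_singleton_self s) hx
  refine Module.length_eq_add_of_exact
    (Submodule.mapQ I (Ideal.span {s} * I) (LinearMap.mulLeft S s) hle)
    (Submodule.factor Ideal.mul_le_left) ?_ (Submodule.factor_surjective _) ?_
  · rw [← LinearMap.ker_eq_bot, LinearMap.ker_eq_bot']
    intro x hx
    obtain ⟨x, rfl⟩ := Submodule.Quotient.mk_surjective _ x
    rw [Submodule.mapQ_apply, Submodule.Quotient.mk_eq_zero, LinearMap.mulLeft_apply,
      Ideal.mem_span_singleton_mul] at hx
    obtain ⟨z, hz, hzx⟩ := hx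
    rw [Submodule.Quotient.mk_eq_zero, ← mul_left_cancel₀ hs hzx]
    exact hz
  · intro y
    obtain ⟨y, rfl⟩ := Submodule.Quotient.mk_surjective _ y
    change Submodule.Quotient.mk y = (0 : S ⧸ Ideal.span {s}) ↔ _
    rw [Submodule.Quotient.mk_eq_zero, Ideal.mem_span_singleton]
    constructor
    · rintro ⟨x, rfl⟩
      exact ⟨Submodule.Quotient.mk x, rfl⟩
    · rintro ⟨x, hx⟩
      obtain ⟨x, rfl⟩ := Submodule.Quotient.mk_surjective _ x
      rw [Submodule.mapQ_apply, Submodule.Quotient.eq] at hx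
      have := Ideal.mem_span_singleton.1 (Ideal.mul_le_left hx)
      have h2 : y = s * x - (LinearMap.mulLeft S s x - y) := by simp
      rw [h2]
      exact dvd_sub (dvd_mul_right _ _) this

/-- A special case of the Krull–Akizuki theorem. -/
theorem ValuationSubring.isPrincipalIdealRing_of_krullDimLE_one {S K : Type*} [CommRing S]
    [IsDomain S] [IsNoetherianRing S] [Ring.KrullDimLE 1 S] [Field K] [Algebra S K]
    [IsFractionRing S K] (V : ValuationSubring K) (hV : ∀ x : S, algebraMap S K x ∈ V) :
    IsPrincipalIdealRing V := by
  refine ((IsBezout.TFAE (R := V)).out 3 1).1 ?_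
  refine ⟨wellFounded_iff_isEmpty_descending_chain.2 ⟨fun ⟨emb, hemb⟩ => ?_⟩⟩
  set a : ℕ → V := fun i => emb (i + 1) with ha
  have hdvd : ∀ i, DvdNotUnit (a (i + 1)) (a i) := fun i => hemb (i + 1)
  have ha0 : ∀ i, a i ≠ 0 := fun i => (hemb i).1
  have hinj : Function.Injective (algebraMap S K) := IsFractionRing.injective S K
  obtain ⟨s, hs0, c, hsc⟩ : ∃ s : S, s ≠ 0 ∧ ∃ c : V, algebraMap S K s = (a 0 : K) * c := by
    obtain ⟨x, y, hy, hxy⟩ := IsFractionRing.div_surjective (A := S) (a 0 : K)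
    have hy0 : algebraMap S K y ≠ 0 := by
      simpa using nonZeroDivisors.ne_zero hy
    rw [div_eq_iff hy0] at hxy
    refine ⟨x, ?_, ⟨_, hV y⟩, hxy⟩
    rintro rfl
    have : (a 0 : K) ≠ 0 := by simpa using ha0 0
    simp_all
  have hlen : Order.coheight (Ideal.span {s}) ≠ ⊤ := by
    rw [← Module.length_quotient, Module.length_ne_top_iff]
    exact isFiniteLength_quotient_span_singleton _ (mem_nonZeroDivisors_of_ne_zero hs0)
  obtain ⟨l, hl⟩ := ENat.ne_top_iff_exists.1 hlen
  set k := l + 1 with hk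
  obtain ⟨⟨d, hd⟩, hda⟩ := IsLocalization.exist_integer_multiples (nonZeroDivisors S)
    (Finset.range (k + 1)) (fun i => (a i : K))
  have hd0 : algebraMap S K d ≠ 0 := by simpa using nonZeroDivisors.ne_zero hd
  have hda' : ∀ i, ∃ x : S, i ≤ k → algebraMap S K x = algebraMap S K d * a i := by
    intro i
    by_cases hi : i ≤ k
    · obtain ⟨x, hx⟩ := hda i (Finset.mem_range.2 (by omega))
      exact ⟨x, fun _ => by rw [hx, Algebra.smul_def]⟩
    · exact ⟨0, fun h => absurd h hi⟩
  choose b hb using hda'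
  let I : Ideal S := Ideal.span (b '' Set.Iic k)
  let T (i : ℕ) : Ideal S :=
    { carrier := {x | ∃ v : V, algebraMap S K x = algebraMap S K d * (a i * v)}
      add_mem' := by
        rintro x y ⟨v, hv⟩ ⟨w, hw⟩
        exact ⟨v + w, by rw [map_add, hv, hw]; push_cast; ring⟩
      zero_mem' := ⟨0, by simp⟩
      smul_mem' := by
        rintro r x ⟨v, hv⟩
        exact ⟨⟨_, hV r⟩ * v, by rw [smul_eq_mul, map_mul, hv]; push_cast; ring⟩ }
  have hanti : ∀ i, T i ≤ T (i + 1) := by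
    rintro i x ⟨v, hv⟩
    obtain ⟨c, -, hc⟩ := (hdvd i).2
    exact ⟨c * v, by rw [hv, hc]; push_cast; rw [mul_assoc]⟩
  have hmono : Monotone T := monotone_nat_of_le_succ hanti
  have hmem : ∀ i ≤ k, b i ∈ T i := fun i hi => ⟨1, by rw [hb i hi]; simp⟩
  have hnot : ∀ i < k, b (i + 1) ∉ T i := by
    rintro i hi ⟨v, hv⟩
    rw [hb _ hi] at hv
    have h1 := mul_left_cancel₀ hd0 hv
    obtain ⟨-, c, hc, hac⟩ := hdvd i
    have h2 : a (i + 1) = a (i + 1) * (c * v) := by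
      rw [← mul_assoc, ← hac]
      exact Subtype.ext (by simpa using h1)
    have h3 : c * v = 1 := (mul_eq_left₀ (ha0 (i + 1))).1 h2.symm
    exact hc (IsUnit.of_mul_eq_one _ h3)
  have hIT : I ≤ T k := by
    refine Ideal.span_le.2 ?_
    rintro _ ⟨i, hi, rfl⟩
    exact hmono hi (hmem i hi)
  have hstep : ∀ i ≤ k, Order.coheight I + i ≤ Order.coheight (I ⊓ T (k - i)) := by
    intro i
    induction i with
    | zero => intro _; simp [inf_eq_left.2 hIT]
    | succ i ih =>
      intro hi
      have hlt : I ⊓ T (k - (i + 1)) < I ⊓ T (k - i) := by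
        have e : k - i = k - (i + 1) + 1 := by omega
        rw [e]
        refine lt_of_le_of_ne (inf_le_inf_left _ (hanti _)) fun heq => ?_
        have : b (k - (i + 1) + 1) ∈ I ⊓ T (k - (i + 1) + 1) :=
          ⟨Ideal.subset_span ⟨_, by simp; omega, rfl⟩, hmem _ (by omega)⟩
        rw [← heq] at this
        exact hnot _ (by omega) this.2
      calc Order.coheight I + ((i + 1 : ℕ) : ℕ∞) = Order.coheight I + i + 1 := by
            push_cast; rw [add_assoc]
        _ ≤ Order.coheight (I ⊓ T (k - i)) + 1 := by gcongr; exact ih (by omega)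
        _ ≤ _ := Order.coheight_add_one_le hlt
  have hsI : Ideal.span {s} * I ≤ I ⊓ T 0 := by
    refine le_inf Ideal.mul_le_right ?_
    rw [Ideal.mul_le]
    intro x hx y hy
    obtain ⟨r, rfl⟩ := Ideal.mem_span_singleton.1 hx
    obtain ⟨v, hv⟩ := hIT hy
    exact ⟨c * ⟨_, hV r⟩ * (a k * v), by rw [map_mul, map_mul, hv, hsc]; push_cast; ring⟩
  have hI0 : b 0 ≠ 0 := by
    intro h0
    have := hb 0 (Nat.zero_le _)
    rw [h0, map_zero, eq_comm, mul_eq_zero] at this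
    exact this.elim hd0 (by simpa using ha0 0)
  have hIfin : Order.coheight I ≠ ⊤ := by
    have h1 : Order.coheight I ≤ Order.coheight (Ideal.span {b 0}) :=
      Order.coheight_anti (by
        rw [Ideal.span_singleton_le_iff_mem]
        exact Ideal.subset_span ⟨0, by simp, rfl⟩)
    refine ne_top_of_le_ne_top ?_ h1
    rw [← Module.length_quotient, Module.length_ne_top_iff]
    exact isFiniteLength_quotient_span_singleton _ (mem_nonZeroDivisors_of_ne_zero hI0)
  have hfin := hstep k le_rfl
  rw [Nat.sub_self] at hfin
  have h4 := hfin.trans (Order.coheight_anti hsI)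
  rw [coheight_span_singleton_mul hs0, ← hl] at h4
  have h5 := (ENat.add_le_add_iff_left hIfin).1 h4
  have h6 : k ≤ l := by exact_mod_cast h5
  omega

universe uR

open IsLocalRing in
/-- A nonzero nonunit of a Noetherian local domain stays nonzero under some local homomorphism
to a discrete valuation ring. -/
theorem exists_isLocalHom_discreteValuationRing {C : Type uR} [CommRing C] [IsDomain C]
    [IsNoetherianRing C] [IsLocalRing C] {f : C} (hf0 : f ≠ 0) (hfm : f ∈ maximalIdeal C) :
    ∃ (V : Type uR) (_ : CommRing V) (_ : IsDomain V) (_ : IsDiscreteValuationRing V)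
      (φ : C →+* V), IsLocalHom φ ∧ φ f ≠ 0 := by
  obtain ⟨Q, ⟨hQp, hfQ⟩, hQmax⟩ := WellFounded.has_min
    (wellFounded_gt (α := Ideal C)) {p | p.IsPrime ∧ f ∉ p} ⟨⊥, Ideal.isPrime_bot, by simpa⟩
  have : IsLocalRing (C ⧸ Q) :=
    IsLocalRing.of_surjective' (Ideal.Quotient.mk Q) Ideal.Quotient.mk_surjective
  have hfS : Ideal.Quotient.mk Q f ≠ 0 := by rwa [Ne, Ideal.Quotient.eq_zero_iff_mem]
  have : Ring.KrullDimLE 1 (C ⧸ Q) := by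
    refine krullDimLE_one_of_mem_of_isPrime hfS fun p hp hp0 => ?_
    by_contra hfp
    refine hQmax (p.comap (Ideal.Quotient.mk Q)) ⟨hp.comap _, hfp⟩ ?_
    refine lt_of_le_of_ne (fun x hx => ?_) fun h => hp0 ?_
    · rw [Ideal.mem_comap, Ideal.Quotient.eq_zero_iff_mem.2 hx]
      exact p.zero_mem
    · rw [← Ideal.map_comap_of_surjective _ Ideal.Quotient.mk_surjective p, ← h,
        Ideal.map_quotient_self]
  let K := FractionRing (C ⧸ Q)
  have hinj : Function.Injective (algebraMap (C ⧸ Q) K) := IsFractionRing.injective _ _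
  let e : (C ⧸ Q) ≃+* (algebraMap (C ⧸ Q) K).range :=
    RingEquiv.ofBijective (algebraMap (C ⧸ Q) K).rangeRestrict
      ⟨fun x y h => hinj (congrArg Subtype.val h), (algebraMap (C ⧸ Q) K).rangeRestrict_surjective⟩
  obtain ⟨B, hB, hm⟩ := Ideal.image_subset_nonunits_valuationSubring
    ((maximalIdeal (C ⧸ Q)).comap e.symm) (Ideal.comap_ne_top _ Ideal.IsPrime.ne_top')
  have hBS : ∀ x, algebraMap (C ⧸ Q) K x ∈ B := fun x => hB ⟨x, rfl⟩
  have := ValuationSubring.isPrincipalIdealRing_of_krullDimLE_one B hBS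
  let ψ : (C ⧸ Q) →+* B := (algebraMap (C ⧸ Q) K).codRestrict B.toSubring hBS
  have hψ : ∀ x ∈ maximalIdeal (C ⧸ Q), ¬ IsUnit (ψ x) := by
    intro x hx
    have h1 : algebraMap (C ⧸ Q) K x ∈ B.nonunits := hm ⟨e x, by simpa using hx, rfl⟩
    obtain ⟨h2, h3⟩ := ValuationSubring.mem_nonunits_iff_exists_mem_maximalIdeal.1 h1
    exact h3
  have hfm' : Ideal.Quotient.mk Q f ∈ maximalIdeal (C ⧸ Q) := by
    have : IsLocalHom (Ideal.Quotient.mk Q) :=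
      IsLocalHom.of_surjective _ Ideal.Quotient.mk_surjective
    exact fun h => hfm (isUnit_of_map_unit _ _ h)
  have hψf : ψ (Ideal.Quotient.mk Q f) ≠ 0 := by
    intro h
    exact hfS (hinj (by rw [map_zero]; exact congrArg Subtype.val h))
  refine ⟨B, inferInstance, inferInstance, ⟨fun h => hψf ?_⟩, ψ.comp (Ideal.Quotient.mk Q),
    ⟨fun x hx => ?_⟩, hψf⟩
  · have : ψ (Ideal.Quotient.mk Q f) ∈ maximalIdeal B := hψ _ hfm'
    rwa [h] at this
  · by_contra hxu
    refine hψ _ ?_ hx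
    have : IsLocalHom (Ideal.Quotient.mk Q) :=
      IsLocalHom.of_surjective _ Ideal.Quotient.mk_surjective
    exact fun h => hxu (isUnit_of_map_unit _ _ h)

open IsLocalRing in
/-- A form of the valuative criterion of integral dependence: either `f` is strictly integral
over `(g, f)`, or some discrete valuation dominating `R` sees `f` divide every `g i`. -/
theorem pow_mem_or_exists_discreteValuationRing {R : Type uR} [CommRing R] [IsDomain R]
    [IsNoetherianRing R] [IsLocalRing R] {f : R} (hf0 : f ≠ 0) (hfm : f ∈ maximalIdeal R)
    {ι : Type*} [Finite ι] (g : ι → R) :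
    (∃ k, f ^ k ∈ maximalIdeal R * (Ideal.span (Set.range g) ⊔ Ideal.span {f}) ^ k) ∨
    ∃ (V : Type uR) (_ : CommRing V) (_ : IsDomain V) (_ : IsDiscreteValuationRing V)
      (φ : R →+* V), IsLocalHom φ ∧ φ f ≠ 0 ∧ ∀ i, φ f ∣ φ (g i) := by
  set J := Ideal.span (Set.range g) ⊔ Ideal.span {f} with hJ
  let K := FractionRing R
  have hinj : Function.Injective (algebraMap R K) := IsFractionRing.injective _ _
  have hfK : algebraMap R K f ≠ 0 := by rwa [Ne, map_eq_zero_iff _ hinj]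
  have hfJ : f ∈ J := Ideal.mem_sup_right (Ideal.mem_span_singleton_self f)
  let h : ι → K := fun i => algebraMap R K (g i) / algebraMap R K f
  let B := Algebra.adjoin R (Set.range h)
  have : Algebra.FiniteType R B := by
    rw [← Subalgebra.fg_iff_finiteType]
    exact Subalgebra.fg_def.2 ⟨_, Set.finite_range h, rfl⟩
  have : IsNoetherianRing B := Algebra.FiniteType.isNoetherianRing R B
  have hBJ : ∀ b ∈ B, ∃ k, ∃ y ∈ J ^ k, algebraMap R K f ^ k * b = algebraMap R K y := by
    intro b hb
    induction hb using Algebra.adjoin_induction with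
    | mem x hx =>
      obtain ⟨i, rfl⟩ := hx
      refine ⟨1, g i, ?_, ?_⟩
      · rw [pow_one]
        exact Ideal.mem_sup_left (Ideal.subset_span ⟨i, rfl⟩)
      · rw [pow_one]; exact mul_div_cancel₀ _ hfK
    | algebraMap r => exact ⟨0, r, by simp, by simp⟩
    | add x y _ _ hx hy =>
      obtain ⟨k, a, ha, ha'⟩ := hx
      obtain ⟨l, b, hb, hb'⟩ := hy
      refine ⟨k + l, a * f ^ l + f ^ k * b, ?_, ?_⟩
      · rw [pow_add]
        exact add_mem (Ideal.mul_mem_mul ha (Ideal.pow_mem_pow hfJ _))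
          (Ideal.mul_mem_mul (Ideal.pow_mem_pow hfJ _) hb)
      · simp only [map_add, map_mul, map_pow, ← ha', ← hb']; ring
    | mul x y _ _ hx hy =>
      obtain ⟨k, a, ha, ha'⟩ := hx
      obtain ⟨l, b, hb, hb'⟩ := hy
      refine ⟨k + l, a * b, ?_, ?_⟩
      · rw [pow_add]
        exact Ideal.mul_mem_mul ha hb
      · simp only [map_mul, ← ha', ← hb']; ring
  by_cases htop : (maximalIdeal R).map (algebraMap R B) = ⊤
  · left
    have key : ∀ b ∈ (maximalIdeal R).map (algebraMap R B), ∃ k, ∃ y ∈ maximalIdeal R * J ^ k,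
        algebraMap R K f ^ k * b = algebraMap R K y := by
      intro b hb
      induction hb using Submodule.span_induction with
      | mem x hx =>
        obtain ⟨r, hr, rfl⟩ := hx
        exact ⟨0, r, by simpa using hr, by simp⟩
      | zero => exact ⟨0, 0, zero_mem _, by simp⟩
      | add x y _ _ hx hy =>
        obtain ⟨k, a, ha, ha'⟩ := hx
        obtain ⟨l, b, hb, hb'⟩ := hy
        refine ⟨k + l, a * f ^ l + b * f ^ k, ?_, ?_⟩
        · refine add_mem ?_ ?_
          · rw [pow_add, ← mul_assoc]
            exact Ideal.mul_mem_mul ha (Ideal.pow_mem_pow hfJ _)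
          · rw [add_comm, pow_add, ← mul_assoc]
            exact Ideal.mul_mem_mul hb (Ideal.pow_mem_pow hfJ _)
        · simp only [map_add, map_mul, map_pow, ← ha', ← hb']; push_cast; ring
      | smul c x _ hx =>
        obtain ⟨k, a, ha, ha'⟩ := hx
        obtain ⟨l, b, hb, hb'⟩ := hBJ c c.2
        refine ⟨k + l, a * b, ?_, ?_⟩
        · rw [pow_add, ← mul_assoc]
          exact Ideal.mul_mem_mul ha hb
        · simp only [map_mul, ← ha', ← hb', smul_eq_mul]; push_cast; ring
    obtain ⟨k, y, hy, hky⟩ := key 1 (htop ▸ Submodule.mem_top)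
    refine ⟨k, ?_⟩
    have : f ^ k = y := hinj (by rw [← hky]; simp)
    rwa [this]
  · right
    obtain ⟨M, hM, hle⟩ := Ideal.exists_le_maximal _ htop
    have := hM.isPrime
    let C := Localization.AtPrime M
    have : IsDomain C := IsLocalization.isDomain_localization M.primeCompl_le_nonZeroDivisors
    have : IsNoetherianRing C := IsLocalization.isNoetherianRing M.primeCompl C inferInstance
    let χ : R →+* C := (algebraMap B C).comp (algebraMap R B)
    have hχm : ∀ r ∈ maximalIdeal R, χ r ∈ maximalIdeal C := by
      intro r hr
      exact (IsLocalization.AtPrime.to_map_mem_maximal_iff C M _).2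
        (hle (Ideal.mem_map_of_mem _ hr))
    have hBC : Function.Injective (algebraMap B C) :=
      IsLocalization.injective C M.primeCompl_le_nonZeroDivisors
    have hχf : χ f ≠ 0 := by
      intro h0
      have h1 : algebraMap R B f = 0 := (map_eq_zero_iff _ hBC).1 h0
      exact hfK (congrArg Subtype.val h1)
    obtain ⟨V, i1, i2, i3, φ, hφ, hφf⟩ := exists_isLocalHom_discreteValuationRing (C := C) hχf (hχm f hfm)
    refine ⟨V, i1, i2, i3, φ.comp χ, ⟨fun r hr => ?_⟩, hφf, fun i => ?_⟩
    · by_contra hru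
      exact hχm r hru (isUnit_of_map_unit φ _ hr)
    · let hi : B := ⟨h i, Algebra.subset_adjoin ⟨i, rfl⟩⟩
      have h1 : algebraMap R B (g i) = algebraMap R B f * hi :=
        Subtype.ext (mul_div_cancel₀ _ hfK).symm
      refine ⟨φ (algebraMap B C hi), ?_⟩
      simp only [χ, RingHom.comp_apply, h1, map_mul]

theorem Algebra.FormallySmooth.of_charZero (K L : Type*) [Field K] [CharZero K] [Field L]
    [Algebra K L] : Algebra.FormallySmooth K L := by
  obtain ⟨s, x, hx⟩ := exists_isTranscendenceBasis' K L
  have := hx.isAlgebraic_field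
  exact .of_algebraicIndependent_of_isSeparable hx.1

/-- The chain rule for substituting polynomials in one variable into a polynomial in several
variables. -/
theorem MvPolynomial.derivative_aeval {K L ι : Type*} [Field K] [CommRing L] [Algebra K L]
    [Fintype ι] (P : ι → Polynomial L) (F : MvPolynomial ι K) :
    Polynomial.derivative (aeval P F) =
      ∑ i, aeval P (pderiv i F) * Polynomial.derivative (P i) := by
  classical
  induction F using MvPolynomial.induction_on with
  | C a => simp [Polynomial.algebraMap_apply]
  | add p q hp hq => simp only [map_add, hp, hq, add_mul, Finset.sum_add_distrib]
  | mul_X p i hp =>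
    have hX : ∑ j, aeval P (pderiv j (X i : MvPolynomial ι K)) * Polynomial.derivative (P j) =
        Polynomial.derivative (P i) := by
      rw [Finset.sum_eq_single_of_mem i (Finset.mem_univ i) fun j _ hj => by
        rw [pderiv_X_of_ne hj.symm, map_zero, zero_mul], pderiv_X_self, map_one, one_mul]
    rw [map_mul, Polynomial.derivative_mul, hp, aeval_X, ← hX, Finset.sum_mul, Finset.mul_sum,
      ← Finset.sum_add_distrib]
    refine Finset.sum_congr rfl fun j _ => ?_
    rw [pderiv_mul, map_add, map_mul, map_mul, aeval_X]
    ring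

open IsLocalRing Polynomial in
/-- Over a discrete valuation ring containing a field of characteristic zero, a polynomial
expression has smaller valuation than some of its partial derivatives. -/
theorem aeval_mem_maximalIdeal_pow_succ {K V ι : Type*} [Field K] [CharZero K] [CommRing V]
    [IsDomain V] [IsDiscreteValuationRing V] [Algebra K V] [Fintype ι] (x : ι → V)
    (F : MvPolynomial ι K) (e : ℕ) (h1 : MvPolynomial.aeval x F ∈ maximalIdeal V ^ (e + 1))
    (h2 : ∀ i, MvPolynomial.aeval x (MvPolynomial.pderiv i F) ∈ maximalIdeal V ^ (e + 1)) :
    MvPolynomial.aeval x F ∈ maximalIdeal V ^ (e + 2) := by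
  obtain ⟨t, ht⟩ := IsDiscreteValuationRing.exists_irreducible V
  have hm := ht.maximalIdeal_eq
  have hmk : ∀ k v, v ∈ maximalIdeal V ^ k ↔ t ^ k ∣ v := fun k v => by
    rw [hm, Ideal.span_singleton_pow, Ideal.mem_span_singleton]
  have hm1 : ∀ v, v ∈ maximalIdeal V ↔ t ∣ v := fun v => by
    rw [hm, Ideal.mem_span_singleton]
  simp only [hmk] at h1 h2 ⊢
  let κ := ResidueField V
  have : CharZero κ := charZero_of_injective_algebraMap (algebraMap K κ).injective
  have := Algebra.FormallySmooth.of_charZero K κ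
  let I := maximalIdeal V ^ (e + 2)
  let W := V ⧸ I
  let π : V →ₐ[K] W := Ideal.Quotient.mkₐ K I
  have hπs : Function.Surjective π := Ideal.Quotient.mk_surjective
  have hπ : ∀ v, π v = 0 ↔ t ^ (e + 2) ∣ v := fun v => by
    rw [← hmk]; exact Ideal.Quotient.eq_zero_iff_mem
  let r : V →ₐ[K] κ := IsScalarTower.toAlgHom K V κ
  have hr : ∀ v, r v = 0 ↔ t ∣ v := fun v => by
    rw [← hm1]; exact residue_eq_zero_iff v
  let g : W →ₐ[K] κ := Ideal.Quotient.liftₐ I r fun v hv => by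
    rw [hr]
    exact (dvd_pow_self t (by omega)).trans ((hmk _ _).1 hv)
  have hgπ : ∀ v, g (π v) = r v := fun v => rfl
  have hgs : Function.Surjective g := fun c => by
    obtain ⟨v, rfl⟩ := residue_surjective c
    exact ⟨π v, rfl⟩
  have hnil : IsNilpotent (RingHom.ker (g : W →+* κ)) := by
    refine ⟨e + 2, ?_⟩
    have : RingHom.ker (g : W →+* κ) ≤ Ideal.span {π t} := by
      intro w hw
      obtain ⟨v, rfl⟩ := hπs w
      obtain ⟨v', rfl⟩ := (hr v).1 hw
      rw [map_mul]
      exact Ideal.mul_mem_right _ _ (Ideal.mem_span_singleton_self _)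
    rw [Ideal.zero_eq_bot, eq_bot_iff]
    refine (Ideal.pow_right_mono this _).trans ?_
    rw [Ideal.span_singleton_pow, ← map_pow, (hπ _).2 dvd_rfl]
    simp
  let σ : κ →ₐ[K] W := Algebra.FormallySmooth.liftOfSurjective (AlgHom.id K κ) g hgs hnil
  have hgσ : ∀ c, g (σ c) = c := fun c =>
    Algebra.FormallySmooth.liftOfSurjective_apply (AlgHom.id K κ) g hgs hnil c
  let ψ : κ[X] →ₐ[K] W := Polynomial.eval₂AlgHom σ (π t) fun _ => mul_comm _ _
  have hψC : ∀ c, ψ (C c) = σ c := fun c => Polynomial.eval₂_C _ _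
  have hψX : ψ X = π t := Polynomial.eval₂_X _ _
  have hψdvd : ∀ k ≤ e + 2, ∀ H : κ[X], (∃ w, ψ H = π (t ^ k * w)) → X ^ k ∣ H := by
    intro k
    induction k with
    | zero => intro _ H _; simp
    | succ k ih =>
      rintro hk H ⟨w, hw⟩
      obtain ⟨H', rfl⟩ := ih (by omega) H ⟨t * w, by rw [hw, pow_succ, mul_assoc]⟩
      obtain ⟨v, hv⟩ := hπs (ψ H')
      have hc : r v = H'.coeff 0 := by
        rw [← hgπ, hv, ← H'.divX_mul_X_add]
        simp [hψC, hψX, hgσ, hgπ, (hr t).2 dvd_rfl]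
      rw [pow_succ]
      refine mul_dvd_mul_left _ (X_dvd_iff.2 ?_)
      rw [← hc, hr]
      rw [map_mul, map_pow, hψX, ← hv, ← map_pow, ← map_mul, ← sub_eq_zero, ← map_sub, hπ] at hw
      have h3 := (dvd_sub_comm.1 ((pow_dvd_pow t hk).trans hw))
      have h4 : t ^ (k + 1) ∣ t ^ k * v := by
        have := dvd_sub (dvd_mul_right (t ^ (k + 1)) w) h3
        simpa using this
      rw [pow_succ] at h4
      exact (mul_dvd_mul_iff_left (pow_ne_zero _ ht.ne_zero)).1 h4
  have hψs : Function.Surjective ψ := by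
    have key : ∀ k v, ∃ (P : κ[X]) (w : V), π v = ψ P + π (t ^ k * w) := by
      intro k
      induction k with
      | zero => exact fun v => ⟨0, v, by simp⟩
      | succ k ih =>
        intro v
        obtain ⟨P, w, hw⟩ := ih v
        obtain ⟨s, hs⟩ := hπs (σ (r w))
        obtain ⟨w', hw'⟩ : t ∣ w - s := by
          rw [← hr, map_sub, ← hgπ s, hs, hgσ, sub_self]
        refine ⟨P + X ^ k * C (r w), w', ?_⟩
        rw [sub_eq_iff_eq_add'] at hw'
        have hπw : π w = π s + π t * π w' := by rw [hw', map_add, map_mul]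
        simp only [hw, map_mul, map_add, map_pow, hψX, hψC, ← hs, hπw]
        ring
    intro w
    obtain ⟨v, rfl⟩ := hπs w
    obtain ⟨P, w, h⟩ := key (e + 2) v
    exact ⟨P, by rw [h, (hπ _).2 (dvd_mul_right _ _), add_zero]⟩
  choose P hP using fun i => hψs (π (x i))
  have haev : ∀ F : MvPolynomial ι K, ψ (MvPolynomial.aeval P F) = π (MvPolynomial.aeval x F) := by
    intro F
    rw [MvPolynomial.comp_aeval_apply, MvPolynomial.comp_aeval_apply]
    simp only [hP]
  have hpd : ∀ i, X ^ (e + 1) ∣ MvPolynomial.aeval P (MvPolynomial.pderiv i F) := fun i => by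
    obtain ⟨w, hw⟩ := h2 i
    exact hψdvd _ (by omega) _ ⟨w, by rw [haev, hw]⟩
  obtain ⟨G, hG⟩ : X ^ (e + 1) ∣ MvPolynomial.aeval P F := by
    obtain ⟨w, hw⟩ := h1
    exact hψdvd _ (by omega) _ ⟨w, by rw [haev, hw]⟩
  have hder : X ^ (e + 1) ∣ derivative (MvPolynomial.aeval P F) := by
    rw [MvPolynomial.derivative_aeval]
    exact Finset.dvd_sum fun i _ => (hpd i).mul_right _
  obtain ⟨G', rfl⟩ : X ∣ G := by
    rw [hG, derivative_mul, dvd_add_left (dvd_mul_right _ _), derivative_X_pow, pow_succ,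
      Nat.add_sub_cancel, mul_comm (C _), mul_assoc,
      mul_dvd_mul_iff_left (pow_ne_zero _ X_ne_zero), X_dvd_iff, coeff_C_mul, mul_eq_zero] at hder
    exact X_dvd_iff.2 (hder.resolve_left (Nat.cast_ne_zero.2 e.succ_ne_zero))
  rw [← hπ, ← haev, hG, ← mul_assoc, ← pow_succ, map_mul, map_pow, hψX, ← map_pow,
    (hπ _).2 dvd_rfl, zero_mul]

open scoped ENNReal Topology

/-- A multiplicative, injective weight on exponents, with values in the positive integers. -/
noncomputable def expWeight {n : ℕ} (α : Fin n →₀ ℕ) : ℕ :=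
  ∏ i : Fin n, Nat.nth Nat.Prime i ^ α i

section expWeight

variable {n : ℕ}

theorem expWeight_zero : expWeight (0 : Fin n →₀ ℕ) = 1 := by simp [expWeight]

theorem expWeight_add (α β : Fin n →₀ ℕ) : expWeight (α + β) = expWeight α * expWeight β := by
  simp [expWeight, pow_add, Finset.prod_mul_distrib]

theorem one_le_expWeight (α : Fin n →₀ ℕ) : 1 ≤ expWeight α :=
  Finset.one_le_prod' fun i _ => Nat.one_le_pow _ _ (Nat.prime_nth_prime i).pos

theorem expWeight_mono {α β : Fin n →₀ ℕ} (h : α ≤ β) : expWeight α ≤ expWeight β := by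
  obtain ⟨γ, rfl⟩ := exists_add_of_le h
  rw [expWeight_add]
  exact Nat.le_mul_of_pos_right _ (one_le_expWeight γ)

theorem lt_expWeight (α : Fin n →₀ ℕ) (i : Fin n) : α i < expWeight α := by
  calc α i < 2 ^ α i := Nat.lt_two_pow_self
    _ ≤ Nat.nth Nat.Prime i ^ α i := Nat.pow_le_pow_left (Nat.prime_nth_prime i).two_le _
    _ ≤ expWeight α := Finset.single_le_prod' (f := fun i : Fin n => Nat.nth Nat.Prime i ^ α i)
        (fun j _ => Nat.one_le_pow _ _ (Nat.prime_nth_prime j).pos) (Finset.mem_univ i)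

theorem expWeight_injective : Function.Injective (expWeight : (Fin n →₀ ℕ) → ℕ) := by
  have key : ∀ (α : Fin n →₀ ℕ) (j : Fin n),
      (expWeight α).factorization (Nat.nth Nat.Prime j) = α j := by
    intro α j
    rw [expWeight, Nat.factorization_prod (g := fun i : Fin n => Nat.nth Nat.Prime i ^ α i)
        fun i _ => pow_ne_zero _ (Nat.prime_nth_prime i).ne_zero,
      Finsupp.finsetSum_apply, Finset.sum_eq_single_of_mem j (Finset.mem_univ j)]
    · simp [Nat.Prime.factorization_pow (Nat.prime_nth_prime j)]
    · intro i _ hij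
      rw [Nat.Prime.factorization_pow (Nat.prime_nth_prime i), Finsupp.single_eq_of_ne]
      exact fun h => hij (Fin.ext (Nat.nth_injective Nat.infinite_setOfPred_prime h)).symm
  intro α β h
  ext j
  rw [← key, h, key]

/-- The weight as a scaling factor. -/
noncomputable def wt (s : ℕ) (α : Fin n →₀ ℕ) : ℝ≥0∞ := ((expWeight α : ℝ≥0∞) ^ s)⁻¹

theorem expWeight_ne_zero (α : Fin n →₀ ℕ) : (expWeight α : ℝ≥0∞) ≠ 0 := by
  have := one_le_expWeight α
  simp; omega

theorem wt_add (s : ℕ) (α β : Fin n →₀ ℕ) : wt s (α + β) = wt s α * wt s β := by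
  rw [wt, wt, wt, expWeight_add, Nat.cast_mul, mul_pow, ENNReal.mul_inv]
  · exact Or.inl (pow_ne_zero _ (expWeight_ne_zero α))
  · exact Or.inl (ENNReal.pow_ne_top (ENNReal.natCast_ne_top _))

theorem wt_add_mul (s : ℕ) (α β : Fin n →₀ ℕ) :
    wt s (α + β) * (expWeight β : ℝ≥0∞) ^ s = wt s α := by
  rw [wt_add, mul_assoc, wt, wt, ENNReal.inv_mul_cancel, mul_one]
  · exact pow_ne_zero _ (expWeight_ne_zero β)
  · exact ENNReal.pow_ne_top (ENNReal.natCast_ne_top _)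

theorem wt_ne_top (s : ℕ) (α : Fin n →₀ ℕ) : wt s α ≠ ⊤ :=
  ENNReal.inv_ne_top.2 (pow_ne_zero _ (expWeight_ne_zero α))

theorem wt_anti {s t : ℕ} (h : s ≤ t) (α : Fin n →₀ ℕ) : wt t α ≤ wt s α :=
  ENNReal.inv_le_inv.2 (pow_le_pow_right₀ (by exact_mod_cast one_le_expWeight α) h)

theorem wt_succ (s : ℕ) (α : Fin n →₀ ℕ) : wt (s + 1) α * expWeight α = wt s α := by
  rw [wt, wt, pow_succ, ENNReal.mul_inv (Or.inr (ENNReal.natCast_ne_top _))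
    (Or.inr (expWeight_ne_zero α)), mul_assoc,
    ENNReal.inv_mul_cancel (expWeight_ne_zero α) (ENNReal.natCast_ne_top _), mul_one]

end expWeight

namespace MvPowerSeries

variable {𝕜 : Type*} [RCLike 𝕜] {n : ℕ}

/-- The weighted `ℓ¹` norm of a formal power series. -/
noncomputable def wnorm (s : ℕ) (p : MvPowerSeries (Fin n) 𝕜) : ℝ≥0∞ :=
  ∑' α, ‖coeff α p‖ₑ * wt s α

theorem wnorm_anti {s t : ℕ} (h : s ≤ t) (p : MvPowerSeries (Fin n) 𝕜) :
    wnorm t p ≤ wnorm s p :=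
  ENNReal.tsum_le_tsum fun α => by gcongr; exact wt_anti h α

theorem wnorm_add_le (s : ℕ) (p q : MvPowerSeries (Fin n) 𝕜) :
    wnorm s (p + q) ≤ wnorm s p + wnorm s q := by
  rw [wnorm, wnorm, wnorm, ← ENNReal.tsum_add]
  refine ENNReal.tsum_le_tsum fun α => ?_
  rw [← add_mul, map_add]
  gcongr
  exact enorm_add_le _ _

theorem wnorm_zero (s : ℕ) : wnorm s (0 : MvPowerSeries (Fin n) 𝕜) = 0 := by simp [wnorm]

theorem wnorm_neg (s : ℕ) (p : MvPowerSeries (Fin n) 𝕜) : wnorm s (-p) = wnorm s p := by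
  simp [wnorm]

theorem wnorm_sub_le (s : ℕ) (p q : MvPowerSeries (Fin n) 𝕜) :
    wnorm s (p - q) ≤ wnorm s p + wnorm s q := by
  rw [sub_eq_add_neg, ← wnorm_neg s q]
  exact wnorm_add_le s p (-q)

theorem wnorm_sum_le {ι : Type*} (s : ℕ) (t : Finset ι) (p : ι → MvPowerSeries (Fin n) 𝕜) :
    wnorm s (∑ i ∈ t, p i) ≤ ∑ i ∈ t, wnorm s (p i) :=
  Finset.le_sum_of_subadditive _ (wnorm_zero s).le (wnorm_add_le s) t p

theorem wnorm_mul_le (s : ℕ) (p q : MvPowerSeries (Fin n) 𝕜) :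
    wnorm s (p * q) ≤ wnorm s p * wnorm s q := by
  classical
  have h1 : wnorm s p * wnorm s q = ∑' x : (Fin n →₀ ℕ) × (Fin n →₀ ℕ),
      ‖coeff x.1 p‖ₑ * wt s x.1 * (‖coeff x.2 q‖ₑ * wt s x.2) := by
    rw [ENNReal.tsum_prod', wnorm, ← ENNReal.tsum_mul_right]
    exact tsum_congr fun α => ENNReal.tsum_mul_left.symm
  rw [h1, ← Finset.HasAntidiagonal.sigmaAntidiagonalEquivProd.tsum_eq, ENNReal.tsum_sigma']
  refine ENNReal.tsum_le_tsum fun α => ?_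
  rw [tsum_fintype, coeff_mul, ← Finset.sum_coe_sort]
  refine (mul_le_mul_left (enorm_sum_le _ _) _).trans ?_
  rw [Finset.sum_mul]
  refine Finset.sum_le_sum fun x _ => ?_
  have hw : wt s α = wt s x.1.1 * wt s x.1.2 := by
    rw [← wt_add, Finset.HasAntidiagonal.mem_antidiagonal.1 x.2]
  rw [Finset.HasAntidiagonal.sigmaAntidiagonalEquivProd_apply, hw, enorm_mul]
  exact le_of_eq (by ring)

theorem wnorm_monomial (s : ℕ) (α : Fin n →₀ ℕ) (c : 𝕜) :
    wnorm s (monomial α c) = ‖c‖ₑ * wt s α := by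
  classical
  rw [wnorm, tsum_eq_single α]
  · simp
  · intro β hβ
    simp [coeff_monomial, hβ]

/-- The part of `a` supported on exponents satisfying `P`, divided by the monomial with
exponent `α`. -/
noncomputable def selShift (P : (Fin n →₀ ℕ) → Prop) (α : Fin n →₀ ℕ)
    (a : MvPowerSeries (Fin n) 𝕜) : MvPowerSeries (Fin n) 𝕜 :=
  open Classical in fun γ => if P (γ + α) then coeff (γ + α) a else 0

open Classical in
theorem coeff_selShift (P : (Fin n →₀ ℕ) → Prop) (α : Fin n →₀ ℕ)
    (a : MvPowerSeries (Fin n) 𝕜) (γ : Fin n →₀ ℕ) :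
    coeff γ (selShift P α a) = if P (γ + α) then coeff (γ + α) a else 0 := rfl

theorem wnorm_selShift_le (P : (Fin n →₀ ℕ) → Prop) (α : Fin n →₀ ℕ)
    (a : MvPowerSeries (Fin n) 𝕜) (s : ℕ) :
    wnorm s (selShift P α a) ≤ wnorm s a * (expWeight α : ℝ≥0∞) ^ s := by
  classical
  rw [wnorm, wnorm, ← ENNReal.tsum_mul_right]
  refine le_trans (ENNReal.tsum_le_tsum fun γ => ?_) (ENNReal.tsum_comp_le_tsum_of_injective
    (add_left_injective α) _)
  rw [coeff_selShift, mul_assoc, wt_add_mul]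
  split_ifs
  · exact le_rfl
  · simp

end MvPowerSeries

namespace MvPowerSeries

variable {𝕜 : Type*} [RCLike 𝕜] {n : ℕ}

/-- `p` has coefficient one at `α`, and `α` is the exponent of least weight in its support. -/
def IsMonicAt (α : Fin n →₀ ℕ) (p : MvPowerSeries (Fin n) 𝕜) : Prop :=
  coeff α p = 1 ∧ ∀ β, coeff β p ≠ 0 → β ≠ α → expWeight α < expWeight β

theorem exists_isMonicAt_smul {p : MvPowerSeries (Fin n) 𝕜} (hp : p ≠ 0) :
    ∃ α, ∃ c : 𝕜, coeff α p ≠ 0 ∧ IsMonicAt α (c • p) := by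
  obtain ⟨β, hβ⟩ : ∃ β, coeff β p ≠ 0 := by
    by_contra! h
    exact hp (MvPowerSeries.ext fun β => by simpa using h β)
  obtain ⟨α, hα, hmin⟩ := exists_minimalFor_of_wellFoundedLT (fun β => coeff β p ≠ 0) expWeight
    ⟨β, hβ⟩
  refine ⟨α, (coeff α p)⁻¹, hα, by simp [hα], fun γ hγ hne => ?_⟩
  have hγ' : coeff γ p ≠ 0 := fun h => hγ (by simp [h])
  by_contra! hlt
  exact hne (expWeight_injective (le_antisymm hlt (hmin hγ' hlt)))

theorem tendsto_wnorm_tail {α : Fin n →₀ ℕ} {p : MvPowerSeries (Fin n) 𝕜} (hp : IsMonicAt α p)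
    {s₀ : ℕ} (hs : wnorm s₀ p ≠ ⊤) :
    Tendsto (fun s => (expWeight α : ℝ≥0∞) ^ s * wnorm s (p - monomial α 1)) atTop (𝓝 0) := by
  classical
  set N : ℝ≥0∞ := ((expWeight α : ℕ) : ℝ≥0∞) with hN
  have hNt : N ≠ ⊤ := ENNReal.natCast_ne_top _
  set q := p - monomial α 1 with hq
  have hqs : wnorm s₀ q ≠ ⊤ := by
    refine ne_top_of_le_ne_top ?_ (wnorm_sub_le s₀ p (monomial α 1))
    rw [wnorm_monomial]
    exact ENNReal.add_ne_top.2 ⟨hs, ENNReal.mul_ne_top enorm_ne_top (wt_ne_top _ _)⟩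
  rw [← tendsto_add_atTop_iff_nat s₀]
  have hle : ∀ s, N ^ (s + s₀) * wnorm (s + s₀) q ≤ (N / (N + 1)) ^ s * (N ^ s₀ * wnorm s₀ q) := by
    intro s
    have : wnorm (s + s₀) q ≤ ((N + 1) ^ s)⁻¹ * wnorm s₀ q := by
      rw [wnorm, wnorm, ← ENNReal.tsum_mul_left]
      refine ENNReal.tsum_le_tsum fun β => ?_
      by_cases hβ : coeff β q = 0
      · simp [hβ]
      · have hβα : β ≠ α := by
          rintro rfl
          exact hβ (by simp [hq, hp.1])
        have hlt := hp.2 β (by simpa [hq, coeff_monomial, hβα] using hβ) hβα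
        have : wt (s + s₀) β ≤ ((N + 1) ^ s)⁻¹ * wt s₀ β := by
          rw [wt, wt, pow_add, ENNReal.mul_inv (Or.inl (pow_ne_zero _ (expWeight_ne_zero β)))
            (Or.inl (ENNReal.pow_ne_top (ENNReal.natCast_ne_top _)))]
          gcongr
          rw [hN]
          exact_mod_cast hlt
        calc _ ≤ ‖coeff β q‖ₑ * (((N + 1) ^ s)⁻¹ * wt s₀ β) := by gcongr
          _ = _ := by ring
    calc _ ≤ N ^ (s + s₀) * (((N + 1) ^ s)⁻¹ * wnorm s₀ q) := by gcongr
      _ = _ := by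
        rw [ENNReal.div_eq_inv_mul, mul_pow, ENNReal.inv_pow, pow_add]
        ring
  refine tendsto_of_tendsto_of_tendsto_of_le_of_le tendsto_const_nhds ?_ (fun _ => zero_le) hle
  have hlt : N / (N + 1) < 1 := by
    rw [ENNReal.div_lt_iff (Or.inl (by simp)) (Or.inl (by simp [hNt])), one_mul]
    exact ENNReal.lt_add_right hNt one_ne_zero
  have := ENNReal.Tendsto.mul_const (ENNReal.tendsto_pow_atTop_nhds_zero_of_lt_one hlt)
    (b := N ^ s₀ * wnorm s₀ q)
    (Or.inr (ENNReal.mul_ne_top (ENNReal.pow_ne_top hNt) hqs))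
  simpa using this

/-- Every power series is recovered from its shifted pieces and a remainder. -/
theorem coeff_sub_sum_selShift {ι : Type*} [Fintype ι] (α : ι → Fin n →₀ ℕ)
    (i : (Fin n →₀ ℕ) → Option ι) (hi : ∀ β j, i β = some j → α j ≤ β)
    (a : MvPowerSeries (Fin n) 𝕜) (β : Fin n →₀ ℕ) (hβ : coeff β
      (a - ∑ j, selShift (fun γ => i γ = some j) (α j) a * monomial (α j) 1) ≠ 0) :
    i β = none ∧ coeff β a ≠ 0 := by
  classical
  have hc : ∀ j, coeff β (selShift (fun γ => i γ = some j) (α j) a * monomial (α j) 1) =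
      if i β = some j then coeff β a else 0 := by
    intro j
    rw [coeff_mul_monomial, coeff_selShift, mul_one]
    by_cases h : α j ≤ β
    · rw [if_pos h, tsub_add_cancel_of_le h]
      congr
    · rw [if_neg h, if_neg fun h' => h (hi _ _ h')]
  rw [map_sub, map_sum, Finset.sum_congr rfl fun j _ => hc j] at hβ
  rcases h : i β with _ | j
  · refine ⟨rfl, fun h0 => hβ ?_⟩
    simp [h0]
  · exact absurd (by simp [h]) hβ

/-- The division theorem for convergent power series. -/
theorem exists_division {ι : Type*} [Fintype ι] (α : ι → Fin n →₀ ℕ)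
    (g : ι → MvPowerSeries (Fin n) 𝕜) (hg : ∀ j, IsMonicAt (α j) (g j))
    (hgc : ∀ j, ∃ s, wnorm s (g j) ≠ ⊤) (f : MvPowerSeries (Fin n) 𝕜)
    (hf : ∃ s, wnorm s f ≠ ⊤) :
    ∃ (q : ι → MvPowerSeries (Fin n) 𝕜) (s : ℕ), (∀ j, wnorm s (q j) ≠ ⊤) ∧
      ∀ β, coeff β (f - ∑ j, q j * g j) ≠ 0 → ∀ j, ¬ α j ≤ β := by
  classical
  obtain ⟨i, hi, hi'⟩ : ∃ i : (Fin n →₀ ℕ) → Option ι,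
      (∀ β j, i β = some j → α j ≤ β) ∧ ∀ β, i β = none → ∀ j, ¬ α j ≤ β := by
    refine ⟨fun β => if h : ∃ j, α j ≤ β then some h.choose else none, fun β j h => ?_,
      fun β h j hj => ?_⟩
    · dsimp only at h
      split_ifs at h with h1
      rw [← Option.some.inj h]
      exact h1.choose_spec
    · dsimp only at h
      rw [dif_pos ⟨j, hj⟩] at h
      cases h
  let Q (j : ι) (a : MvPowerSeries (Fin n) 𝕜) : MvPowerSeries (Fin n) 𝕜 :=
    selShift (fun γ => i γ = some j) (α j) a
  let tl (j : ι) : MvPowerSeries (Fin n) 𝕜 := g j - monomial (α j) 1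
  let T (a : MvPowerSeries (Fin n) 𝕜) : MvPowerSeries (Fin n) 𝕜 := ∑ j, Q j a * tl j
  obtain ⟨s, hfs, hTs⟩ : ∃ s, wnorm s f ≠ ⊤ ∧ ∀ a, wnorm s (T a) ≤ wnorm s a * 2⁻¹ := by
    obtain ⟨s₁, hs₁⟩ := hf
    have ht : Tendsto (fun s => ∑ j, (expWeight (α j) : ℝ≥0∞) ^ s * wnorm s (tl j)) atTop
        (𝓝 (∑ _j : ι, 0)) :=
      tendsto_finsetSum _ fun j _ => tendsto_wnorm_tail (hg j) (hgc j).choose_spec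
    rw [Finset.sum_const_zero] at ht
    obtain ⟨s, hs, hss⟩ := ((ht.eventually_lt_const (u := 2⁻¹) (by simp)).and
      (eventually_ge_atTop s₁)).exists
    refine ⟨s, ne_top_of_le_ne_top hs₁ (wnorm_anti hss f), fun a => ?_⟩
    calc wnorm s (T a) ≤ ∑ j, wnorm s (Q j a * tl j) := wnorm_sum_le _ _ _
      _ ≤ ∑ j, wnorm s a * ((expWeight (α j) : ℝ≥0∞) ^ s * wnorm s (tl j)) := by
        refine Finset.sum_le_sum fun j _ => (wnorm_mul_le _ _ _).trans ?_
        rw [← mul_assoc]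
        exact mul_le_mul_left (wnorm_selShift_le _ _ _ _) _
      _ ≤ _ := by
        rw [← Finset.mul_sum]
        gcongr
  have hTloc : ∀ (a b : MvPowerSeries (Fin n) 𝕜) β,
      (∀ γ, expWeight γ < expWeight β → coeff γ a = coeff γ b) →
      coeff β (T a) = coeff β (T b) := by
    intro a b β h
    simp only [T, map_sum, coeff_mul]
    refine Finset.sum_congr rfl fun j _ => Finset.sum_congr rfl fun x hx => ?_
    have hx' := Finset.HasAntidiagonal.mem_antidiagonal.1 hx
    by_cases hx0 : coeff x.2 (tl j) = 0
    · simp [hx0]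
    · congr 1
      simp only [Q, coeff_selShift]
      rw [h]
      have hne : x.2 ≠ α j := fun he => hx0 (by simp [tl, he, (hg j).1])
      have := (hg j).2 x.2 (by simpa [tl, coeff_monomial, hne] using hx0) hne
      rw [← hx', expWeight_add, expWeight_add]
      exact Nat.mul_lt_mul_of_pos_left this (one_le_expWeight _)
  let A : ℕ → MvPowerSeries (Fin n) 𝕜 := fun k => (fun a => f - T a)^[k] 0
  have hA : ∀ k, A (k + 1) = f - T (A k) := fun k => Function.iterate_succ_apply' _ _ _
  have hAstab : ∀ k l β, expWeight β ≤ k → expWeight β ≤ l → coeff β (A k) = coeff β (A l) := by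
    intro k
    induction k with
    | zero => intro l β h; exact absurd h (by have := one_le_expWeight β; omega)
    | succ k ih =>
      intro l β hk hl
      obtain ⟨l, rfl⟩ : ∃ l', l = l' + 1 := ⟨l - 1, by have := one_le_expWeight β; omega⟩
      rw [hA, hA, map_sub, map_sub, hTloc (A k) (A l) β fun γ hγ => ih l γ (by omega) (by omega)]
  let a : MvPowerSeries (Fin n) 𝕜 := fun β => coeff β (A (expWeight β))
  have haA : ∀ β k, expWeight β ≤ k → coeff β a = coeff β (A k) := fun β k hk =>
    hAstab _ _ _ le_rfl hk
  have ha : a = f - T a := by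
    ext β
    rw [haA β (expWeight β + 1) (by omega), hA, map_sub, map_sub,
      hTloc (A (expWeight β)) a β fun γ hγ => (haA γ _ hγ.le).symm]
  have hAs : ∀ k, wnorm s (A k) ≤ 2 * wnorm s f := by
    intro k
    induction k with
    | zero => simp [A, wnorm_zero]
    | succ k ih =>
      rw [hA]
      calc _ ≤ wnorm s f + wnorm s (A k) * 2⁻¹ := (wnorm_sub_le _ _ _).trans (by gcongr; exact hTs _)
        _ ≤ wnorm s f + 2 * wnorm s f * 2⁻¹ := by gcongr
        _ = _ := by
          rw [mul_comm 2, mul_assoc, ENNReal.mul_inv_cancel (by simp) (by simp), mul_one, mul_two]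
  have has : wnorm s a ≠ ⊤ := by
    refine ne_top_of_le_ne_top (ENNReal.mul_ne_top (by simp) hfs : 2 * wnorm s f ≠ ⊤) ?_
    rw [wnorm, ENNReal.tsum_eq_iSup_sum]
    refine iSup_le fun F => ?_
    refine le_trans (le_of_eq ?_) ((ENNReal.sum_le_tsum F).trans (hAs (F.sup expWeight)))
    exact Finset.sum_congr rfl fun β hβ => by rw [haA β _ (Finset.le_sup hβ)]
  refine ⟨fun j => Q j a, s, fun j => ne_top_of_le_ne_top (ENNReal.mul_ne_top has
    (ENNReal.pow_ne_top (ENNReal.natCast_ne_top _))) (wnorm_selShift_le _ _ _ _), fun β hβ => ?_⟩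
  have hrw : f - ∑ j, Q j a * g j = a - ∑ j, Q j a * monomial (α j) 1 := by
    have : ∑ j, Q j a * g j = T a + ∑ j, Q j a * monomial (α j) 1 := by
      rw [← Finset.sum_add_distrib]
      exact Finset.sum_congr rfl fun j _ => by simp only [tl]; ring
    rw [this, ← sub_sub, ← ha]
  rw [hrw] at hβ
  exact hi' β (coeff_sub_sum_selShift α i hi a β hβ).1

end MvPowerSeries

namespace MvPowerSeries

variable {𝕜 : Type*} [RCLike 𝕜] {n : ℕ}

theorem wnorm_pderiv_le (s : ℕ) (i : Fin n) (p : MvPowerSeries (Fin n) 𝕜) :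
    wnorm (s + 1) (pderiv 𝕜 i p) ≤
      wnorm s p * (expWeight (Finsupp.single i 1) : ℝ≥0∞) ^ (s + 1) := by
  rw [wnorm, wnorm, ← ENNReal.tsum_mul_right]
  refine le_trans (ENNReal.tsum_le_tsum fun γ => ?_) (ENNReal.tsum_comp_le_tsum_of_injective
    (add_left_injective (Finsupp.single i 1)) _)
  have h1 : ‖((γ i + 1 : ℕ) : 𝕜)‖ₑ ≤ (expWeight (γ + Finsupp.single i 1) : ℝ≥0∞) := by
    have h2 := (lt_expWeight (γ + Finsupp.single i 1) i).le
    rw [Finsupp.add_apply, Finsupp.single_eq_same] at h2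
    rw [← ofReal_norm, RCLike.norm_natCast, ENNReal.ofReal_natCast]
    exact_mod_cast h2
  have h3 : coeff γ (pderiv 𝕜 i p) =
      coeff (γ + Finsupp.single i 1) p * ((γ i + 1 : ℕ) : 𝕜) := by
    rw [coeff_pderiv]; push_cast; rfl
  rw [h3, enorm_mul, ← wt_add_mul (s + 1) γ (Finsupp.single i 1),
    ← wt_succ s (γ + Finsupp.single i 1)]
  calc _ ≤ ‖coeff (γ + Finsupp.single i 1) p‖ₑ * (expWeight (γ + Finsupp.single i 1) : ℝ≥0∞) *
        (wt (s + 1) (γ + Finsupp.single i 1) *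
          (expWeight (Finsupp.single i 1) : ℝ≥0∞) ^ (s + 1)) := by gcongr
    _ = _ := by ring

variable (𝕜 n) in
/-- The ring of convergent power series. -/
def convergent : Subalgebra 𝕜 (MvPowerSeries (Fin n) 𝕜) where
  carrier := {p | ∃ s, wnorm s p ≠ ⊤}
  mul_mem' := by
    rintro p q ⟨s, hs⟩ ⟨t, ht⟩
    refine ⟨max s t, ne_top_of_le_ne_top (ENNReal.mul_ne_top hs ht) ((wnorm_mul_le _ _ _).trans ?_)⟩
    exact mul_le_mul' (wnorm_anti (le_max_left _ _) p) (wnorm_anti (le_max_right _ _) q)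
  add_mem' := by
    rintro p q ⟨s, hs⟩ ⟨t, ht⟩
    refine ⟨max s t, ne_top_of_le_ne_top (ENNReal.add_ne_top.2 ⟨hs, ht⟩)
      ((wnorm_add_le _ _ _).trans ?_)⟩
    exact add_le_add (wnorm_anti (le_max_left _ _) p) (wnorm_anti (le_max_right _ _) q)
  algebraMap_mem' c := by
    refine ⟨0, ?_⟩
    rw [algebraMap_apply, Algebra.algebraMap_self, RingHom.id_apply, ← monomial_zero_eq_C_apply,
      wnorm_monomial]
    exact ENNReal.mul_ne_top enorm_ne_top (wt_ne_top _ _)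

theorem monomial_mem_convergent (α : Fin n →₀ ℕ) (c : 𝕜) : monomial α c ∈ convergent 𝕜 n :=
  ⟨0, by rw [wnorm_monomial]; exact ENNReal.mul_ne_top enorm_ne_top (wt_ne_top _ _)⟩

namespace convergent

/-- The coordinates. -/
noncomputable def X (i : Fin n) : convergent 𝕜 n :=
  ⟨MvPowerSeries.X i, monomial_mem_convergent _ _⟩

/-- The partial derivatives. -/
noncomputable def pderiv (i : Fin n) (p : convergent 𝕜 n) : convergent 𝕜 n :=
  ⟨MvPowerSeries.pderiv 𝕜 i p, by
    obtain ⟨s, hs⟩ := p.2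
    exact ⟨s + 1, ne_top_of_le_ne_top (ENNReal.mul_ne_top hs
      (ENNReal.pow_ne_top (ENNReal.natCast_ne_top _))) (wnorm_pderiv_le s i _)⟩⟩

instance : IsDomain (convergent 𝕜 n) :=
  have : IsDomain (MvPowerSeries (Fin n) 𝕜) := NoZeroDivisors.to_isDomain _
  Subtype.coe_injective.isDomain (convergent 𝕜 n).val.toRingHom

theorem exists_division {ι : Type*} [Fintype ι] (α : ι → Fin n →₀ ℕ)
    (g : ι → convergent 𝕜 n) (hg : ∀ j, IsMonicAt (α j) (g j : MvPowerSeries (Fin n) 𝕜))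
    (f : convergent 𝕜 n) :
    ∃ q : ι → convergent 𝕜 n, ∀ β,
      coeff β ((f - ∑ j, q j * g j : convergent 𝕜 n) : MvPowerSeries (Fin n) 𝕜) ≠ 0 →
        ∀ j, ¬ α j ≤ β := by
  obtain ⟨q, s, hq, h⟩ := MvPowerSeries.exists_division α (fun j => (g j).1) hg
    (fun j => (g j).2) f.1 f.2
  refine ⟨fun j => ⟨q j, s, hq j⟩, fun β hβ => h β ?_⟩
  simpa using hβ

instance : IsNoetherianRing (convergent 𝕜 n) := by
  rw [isNoetherianRing_iff_ideal_fg]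
  intro I
  let E : Set (Fin n →₀ ℕ) := {α | ∃ p ∈ I, IsMonicAt α (p : MvPowerSeries (Fin n) 𝕜)}
  have hE : E.IsPWO := Set.isPWO_of_wellQuasiOrderedLE E
  have hfin : {α | Minimal (· ∈ E) α}.Finite :=
    WellQuasiOrderedLE.finite_of_isAntichain (setOfPred_minimal_antichain _)
  have := hfin.fintype
  choose g hgI hg using fun α : {α | Minimal (· ∈ E) α} => α.2.1
  refine ⟨(Set.finite_range g).toFinset, le_antisymm (Ideal.span_le.2 ?_) fun p hp => ?_⟩
  · simp only [Set.Finite.coe_toFinset]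
    rintro _ ⟨α, rfl⟩
    exact hgI α
  · obtain ⟨q, hq⟩ := exists_division (fun α : {α | Minimal (· ∈ E) α} => α.1) g hg p
    set r := p - ∑ j, q j * g j with hr
    have hrI : r ∈ I := I.sub_mem hp (I.sum_mem fun j _ => I.mul_mem_left _ (hgI j))
    have hr0 : r = 0 := by
      by_contra hne
      obtain ⟨β, c, hβ, hm⟩ := exists_isMonicAt_smul (p := (r : MvPowerSeries (Fin n) 𝕜))
        fun h => hne (Subtype.ext h)
      have hcI : c • r ∈ I := by
        rw [Algebra.smul_def]
        exact I.mul_mem_left _ hrI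
      obtain ⟨α, hαβ, hα⟩ := hE.exists_le_minimal (a := β) ⟨c • r, hcI, hm⟩
      exact hq β hβ ⟨α, hα⟩ hαβ
    rw [sub_eq_zero.1 (hr.symm.trans hr0)]
    exact Ideal.sum_mem _ fun j _ => Ideal.mul_mem_left _ _ (Ideal.subset_span (by simp))

end convergent

end MvPowerSeries

namespace MvPowerSeries

namespace convergent

variable {𝕜 : Type*} [RCLike 𝕜] {n : ℕ}

theorem coe_X (i : Fin n) : ((X i : convergent 𝕜 n) : MvPowerSeries (Fin n) 𝕜) =
    MvPowerSeries.X i := rfl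

theorem coe_pderiv (i : Fin n) (p : convergent 𝕜 n) :
    (pderiv i p : MvPowerSeries (Fin n) 𝕜) = MvPowerSeries.pderiv 𝕜 i p := rfl

variable (𝕜 n) in
/-- The constant coefficient of a convergent power series. -/
noncomputable def constantCoeff : convergent 𝕜 n →+* 𝕜 :=
  MvPowerSeries.constantCoeff.comp (convergent 𝕜 n).val.toRingHom

theorem constantCoeff_apply (p : convergent 𝕜 n) :
    constantCoeff 𝕜 n p = coeff 0 (p : MvPowerSeries (Fin n) 𝕜) := rfl

theorem isUnit_of_constantCoeff_ne_zero {p : convergent 𝕜 n} (hp : constantCoeff 𝕜 n p ≠ 0) :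
    IsUnit p := by
  have hm : IsMonicAt 0 (((constantCoeff 𝕜 n p)⁻¹ • p : convergent 𝕜 n) :
      MvPowerSeries (Fin n) 𝕜) := by
    refine ⟨by simpa [constantCoeff_apply] using inv_mul_cancel₀ hp, fun β _ hβ => ?_⟩
    exact lt_of_le_of_ne (expWeight_mono zero_le) fun h => hβ (expWeight_injective h).symm
  obtain ⟨q, hq⟩ := exists_division (fun _ : Unit => 0) _ (fun _ => hm) 1
  refine IsUnit.of_mul_eq_one (q () * algebraMap 𝕜 _ (constantCoeff 𝕜 n p)⁻¹) ?_
  have : 1 - ∑ j, q j * ((constantCoeff 𝕜 n p)⁻¹ • p) = 0 := by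
    refine Subtype.ext (MvPowerSeries.ext fun β => ?_)
    by_contra h
    exact hq β h () zero_le
  rw [sub_eq_zero] at this
  rw [this]
  simp [Algebra.smul_def]
  ring

theorem isUnit_iff {p : convergent 𝕜 n} : IsUnit p ↔ constantCoeff 𝕜 n p ≠ 0 :=
  ⟨fun h => (h.map _).ne_zero, isUnit_of_constantCoeff_ne_zero⟩

instance : IsLocalRing (convergent 𝕜 n) :=
  IsLocalRing.of_isUnit_or_isUnit_of_isUnit_add fun a b h => by
    rw [isUnit_iff] at h ⊢
    rw [isUnit_iff]
    by_contra! hab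
    exact h (by rw [map_add, hab.1, hab.2, add_zero])

theorem mem_maximalIdeal_iff {p : convergent 𝕜 n} :
    p ∈ IsLocalRing.maximalIdeal (convergent 𝕜 n) ↔ constantCoeff 𝕜 n p = 0 := by
  rw [IsLocalRing.mem_maximalIdeal, mem_nonunits_iff, isUnit_iff, not_not]

theorem mem_span_range_X_pow (k : ℕ) (p : convergent 𝕜 n)
    (hp : ∀ β : Fin n →₀ ℕ, β.degree < k → coeff β (p : MvPowerSeries (Fin n) 𝕜) = 0) :
    p ∈ Ideal.span (Set.range (X : Fin n → convergent 𝕜 n)) ^ k := by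
  classical
  induction k generalizing p with
  | zero => simp
  | succ k ih =>
    let i : (Fin n →₀ ℕ) → Option (Fin n) := fun β =>
      if h : ∃ j, Finsupp.single j 1 ≤ β then some h.choose else none
    have hi : ∀ β j, i β = some j → Finsupp.single j 1 ≤ β := fun β j h => by
      simp only [i] at h
      split_ifs at h with h1
      rw [← Option.some.inj h]
      exact h1.choose_spec
    have hi' : ∀ β, i β = none → β = 0 := fun β h => by
      by_contra hβ
      obtain ⟨j, hj⟩ := DFunLike.ne_iff.1 hβ
      have : ∃ j, Finsupp.single j 1 ≤ β :=
        ⟨j, Finsupp.single_le_iff.2 (Nat.one_le_iff_ne_zero.2 hj)⟩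
      simp only [i, dif_pos this, reduceCtorEq] at h
    obtain ⟨s, hs⟩ := p.2
    let q : Fin n → convergent 𝕜 n := fun j =>
      ⟨selShift (fun γ => i γ = some j) (Finsupp.single j 1) p, s,
        ne_top_of_le_ne_top (ENNReal.mul_ne_top hs
          (ENNReal.pow_ne_top (ENNReal.natCast_ne_top _))) (wnorm_selShift_le _ _ _ _)⟩
    have hpq : p = ∑ j, q j * X j := by
      rw [← sub_eq_zero]
      refine Subtype.ext (MvPowerSeries.ext fun β => ?_)
      by_contra h
      have := coeff_sub_sum_selShift (fun j => Finsupp.single j 1) i hi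
        (p : MvPowerSeries (Fin n) 𝕜) β (by simpa [q, coe_X, MvPowerSeries.X] using h)
      obtain rfl := hi' β this.1
      exact this.2 (hp 0 (by simp))
    rw [hpq, pow_succ]
    refine Ideal.sum_mem _ fun j _ => Ideal.mul_mem_mul (ih _ fun β hβ => ?_)
      (Ideal.subset_span ⟨j, rfl⟩)
    simp only [q, coeff_selShift]
    rw [hp _ (by simpa using hβ), ite_self]

theorem maximalIdeal_eq_span : IsLocalRing.maximalIdeal (convergent 𝕜 n) =
    Ideal.span (Set.range X) := by
  refine le_antisymm (fun p hp => ?_) (Ideal.span_le.2 ?_)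
  · rw [← pow_one (Ideal.span _)]
    refine mem_span_range_X_pow 1 p fun β hβ => ?_
    obtain rfl : β = 0 := β.degree_eq_zero_iff.1 (by omega)
    exact mem_maximalIdeal_iff.1 hp
  · rintro _ ⟨i, rfl⟩
    exact mem_maximalIdeal_iff.2 (by simp [constantCoeff_apply, coe_X])

end convergent

end MvPowerSeries

namespace MvPowerSeries

namespace convergent

variable {𝕜 : Type*} [RCLike 𝕜] {n : ℕ}

theorem coe_aeval_X (F : MvPolynomial (Fin n) 𝕜) :
    ((MvPolynomial.aeval X F : convergent 𝕜 n) : MvPowerSeries (Fin n) 𝕜) = F := by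
  have : (convergent 𝕜 n).val.comp (MvPolynomial.aeval X) =
      MvPolynomial.coeToMvPowerSeries.algHom 𝕜 := by
    refine MvPolynomial.algHom_ext fun i => ?_
    simp [coe_X]
  simpa using DFunLike.congr_fun this F

theorem sub_mem_maximalIdeal_pow {k : ℕ} {p q : convergent 𝕜 n}
    (h : ∀ β : Fin n →₀ ℕ, β.degree < k → coeff β (p : MvPowerSeries (Fin n) 𝕜) =
      coeff β (q : MvPowerSeries (Fin n) 𝕜)) :
    p - q ∈ IsLocalRing.maximalIdeal (convergent 𝕜 n) ^ k := by
  rw [maximalIdeal_eq_span]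
  exact mem_span_range_X_pow k _ fun β hβ => by simp [h β hβ]

theorem not_dvd_pderiv {V : Type*} [CommRing V] [IsDomain V] [IsDiscreteValuationRing V]
    (φ : convergent 𝕜 n →+* V) [IsLocalHom φ] {f : convergent 𝕜 n} (hφ : φ f ≠ 0)
    (hf : constantCoeff 𝕜 n f = 0) : ¬ ∀ i, φ f ∣ φ (pderiv i f) := by
  intro hdvd
  let := (φ.comp (algebraMap 𝕜 (convergent 𝕜 n))).toAlgebra
  obtain ⟨ϖ, hϖ⟩ := IsDiscreteValuationRing.exists_irreducible V
  have hm : ∀ k v, v ∈ IsLocalRing.maximalIdeal V ^ k ↔ ϖ ^ k ∣ v := fun k v => by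
    rw [hϖ.maximalIdeal_eq, Ideal.span_singleton_pow, Ideal.mem_span_singleton]
  have hφm : ∀ k p, p ∈ IsLocalRing.maximalIdeal (convergent 𝕜 n) ^ k →
      φ p ∈ IsLocalRing.maximalIdeal V ^ k := fun k p hp => by
    have h1 := Ideal.mem_map_of_mem φ hp
    rw [Ideal.map_pow] at h1
    exact Ideal.pow_right_mono (((IsLocalRing.local_hom_TFAE φ).out 0 2).1 ‹_›) k h1
  obtain ⟨k, u, hu⟩ := IsDiscreteValuationRing.eq_unit_mul_pow_irreducible hφ hϖ
  obtain ⟨e, rfl⟩ : ∃ e, k = e + 1 := by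
    refine Nat.exists_eq_succ_of_ne_zero ?_
    rintro rfl
    have : IsUnit (φ f) := by rw [hu]; simp
    exact isUnit_iff.1 (IsUnit.of_map φ f this) hf
  set F : MvPolynomial (Fin n) 𝕜 := truncTotal (e + 3) (f : MvPowerSeries (Fin n) 𝕜) with hF
  have hev : ∀ G : MvPolynomial (Fin n) 𝕜,
      φ (MvPolynomial.aeval X G) = MvPolynomial.aeval (fun i => φ (X i)) G := fun G => by
    have := MvPolynomial.comp_aeval_apply (X : Fin n → convergent 𝕜 n)
      ({ φ with commutes' := fun _ => rfl } : convergent 𝕜 n →ₐ[𝕜] V) G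
    exact this
  have h1 : φ f - MvPolynomial.aeval (fun i => φ (X i)) F ∈ IsLocalRing.maximalIdeal V ^ (e + 2) := by
    rw [← hev, ← map_sub]
    refine hφm _ _ (sub_mem_maximalIdeal_pow fun β hβ => ?_)
    rw [coe_aeval_X, MvPolynomial.coeff_coe, coeff_truncTotal _ (by omega)]
  have h2 : ∀ i, φ (pderiv i f) - MvPolynomial.aeval (fun i => φ (X i)) (MvPolynomial.pderiv i F) ∈
      IsLocalRing.maximalIdeal V ^ (e + 1) := fun i => by
    rw [← hev, ← map_sub]
    refine hφm _ _ (sub_mem_maximalIdeal_pow fun β hβ => ?_)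
    rw [coe_aeval_X, ← pderiv_coe, coe_pderiv, coeff_pderiv, coeff_pderiv, MvPolynomial.coeff_coe,
      coeff_truncTotal _ (by simp; omega)]
  have hlt : ϖ ^ (e + 1) ∣ φ f := ⟨u, by rw [hu, mul_comm]⟩
  have h3 := aeval_mem_maximalIdeal_pow_succ (fun i => φ (X i)) F e
    ((Submodule.sub_mem_iff_right _ ((hm _ _).2 hlt)).1
      (Ideal.pow_le_pow_right (by omega) h1))
    (fun i => (Submodule.sub_mem_iff_right _ ((hm _ _).2 (hlt.trans (hdvd i)))).1 (h2 i))
  have h4 := (Submodule.sub_mem_iff_left _ h3).1 h1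
  rw [hm, hu, pow_succ _ (e + 1), mul_comm _ (ϖ ^ (e + 1)),
    mul_dvd_mul_iff_left (pow_ne_zero _ hϖ.ne_zero)] at h4
  exact hϖ.not_isUnit (isUnit_of_dvd_unit h4 u.isUnit)

theorem exists_pow_mem {f : convergent 𝕜 n} (hf0 : f ≠ 0) (hf : constantCoeff 𝕜 n f = 0) :
    ∃ k, f ^ k ∈ IsLocalRing.maximalIdeal (convergent 𝕜 n) *
      (Ideal.span (Set.range fun i => pderiv i f) ⊔ Ideal.span {f}) ^ k := by
  rcases pow_mem_or_exists_discreteValuationRing hf0 (mem_maximalIdeal_iff.2 hf)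
    (fun i => pderiv i f) with h | ⟨V, _, _, _, φ, hφ, hφf, hdvd⟩
  · exact h
  · exact absurd hdvd (not_dvd_pderiv φ hφf hf)

end convergent

end MvPowerSeries

section mon

variable {𝕜 : Type*} [RCLike 𝕜] {n : ℕ}

/-- The value at `z` of the monomial with exponent `α`. -/
def mon (z : EuclideanSpace 𝕜 (Fin n)) (α : Fin n →₀ ℕ) : 𝕜 := ∏ i, z i ^ α i

theorem mon_zero (z : EuclideanSpace 𝕜 (Fin n)) : mon z 0 = 1 := by simp [mon]

theorem mon_add (z : EuclideanSpace 𝕜 (Fin n)) (α β : Fin n →₀ ℕ) :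
    mon z (α + β) = mon z α * mon z β := by
  simp [mon, pow_add, Finset.prod_mul_distrib]

theorem mon_single (z : EuclideanSpace 𝕜 (Fin n)) (i : Fin n) :
    mon z (Finsupp.single i 1) = z i := by
  classical
  rw [mon, Finset.prod_eq_single i] <;> simp +contextual [eq_comm]

theorem wt_zero (s : ℕ) : wt s (0 : Fin n →₀ ℕ) = 1 := by simp [wt, expWeight_zero]

theorem wt_ne_zero (s : ℕ) (α : Fin n →₀ ℕ) : wt s α ≠ 0 :=
  ENNReal.inv_ne_zero.2 (ENNReal.pow_ne_top (ENNReal.natCast_ne_top _))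

theorem wt_single_le (s : ℕ) (i : Fin n) : wt s (Finsupp.single i 1) ≤ (2 ^ s)⁻¹ := by
  rw [wt]
  gcongr
  have := lt_expWeight (Finsupp.single i 1) i
  rw [Finsupp.single_eq_same] at this
  exact_mod_cast this

/-- The polydisc on which the series with finite weighted norm converge. -/
def polydisc (𝕜 : Type*) [RCLike 𝕜] (n s : ℕ) : Set (EuclideanSpace 𝕜 (Fin n)) :=
  {z | ∀ i, ‖z i‖ₑ ≤ wt s (Finsupp.single i 1)}

theorem polydisc_anti {s t : ℕ} (h : s ≤ t) : polydisc 𝕜 n t ⊆ polydisc 𝕜 n s :=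
  fun _ hz i => (hz i).trans (wt_anti h _)

theorem polydisc_mem_nhds (s : ℕ) : polydisc 𝕜 n s ∈ 𝓝 0 := by
  refine eventually_all.2 fun i => ?_
  have h : Tendsto (fun z : EuclideanSpace 𝕜 (Fin n) => ‖z i‖ₑ) (𝓝 0) (𝓝 0) := by
    have : Continuous fun z : EuclideanSpace 𝕜 (Fin n) => ‖z i‖ₑ := by fun_prop
    simpa using this.tendsto 0
  exact (h.eventually_lt_const (pos_iff_ne_zero.2 (wt_ne_zero s _))).mono fun _ => le_of_lt

theorem enorm_mon_le {s : ℕ} {z : EuclideanSpace 𝕜 (Fin n)} (hz : z ∈ polydisc 𝕜 n s)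
    (α : Fin n →₀ ℕ) : ‖mon z α‖ₑ ≤ wt s α := by
  induction α using Finsupp.induction_linear with
  | zero => simp [mon_zero, wt_zero]
  | add α β hα hβ =>
    rw [mon_add, wt_add, enorm_mul]
    exact mul_le_mul' hα hβ
  | single i k =>
    induction k with
    | zero => simp [mon_zero, wt_zero]
    | succ k ih =>
      rw [Finsupp.single_add, mon_add, wt_add, enorm_mul, mon_single]
      exact mul_le_mul' ih (hz i)

end mon

namespace MvPowerSeries

variable {𝕜 : Type*} [RCLike 𝕜] {n : ℕ}

/-- The sum of a power series at a point. -/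
noncomputable def sum (p : MvPowerSeries (Fin n) 𝕜) (z : EuclideanSpace 𝕜 (Fin n)) : 𝕜 :=
  ∑' α, coeff α p * mon z α

theorem summable_norm_of_mem_polydisc {s : ℕ} {p : MvPowerSeries (Fin n) 𝕜} (hp : wnorm s p ≠ ⊤)
    {z : EuclideanSpace 𝕜 (Fin n)} (hz : z ∈ polydisc 𝕜 n s) :
    Summable fun α => ‖coeff α p * mon z α‖ := by
  rw [← tsum_enorm_ne_top_iff_summable_norm]
  refine ne_top_of_le_ne_top hp (ENNReal.tsum_le_tsum fun α => ?_)
  rw [enorm_mul]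
  gcongr
  exact enorm_mon_le hz α

theorem norm_sum_le {s : ℕ} {p : MvPowerSeries (Fin n) 𝕜} (hp : wnorm s p ≠ ⊤)
    {z : EuclideanSpace 𝕜 (Fin n)} (hz : z ∈ polydisc 𝕜 n s) :
    ‖p.sum z‖ ≤ (wnorm s p).toReal := by
  rw [← toReal_enorm]
  refine ENNReal.toReal_mono hp (enorm_tsum_le_tsum_enorm.trans (ENNReal.tsum_le_tsum fun α => ?_))
  rw [enorm_mul]
  gcongr
  exact enorm_mon_le hz α

theorem sum_add {s : ℕ} {p q : MvPowerSeries (Fin n) 𝕜} (hp : wnorm s p ≠ ⊤) (hq : wnorm s q ≠ ⊤)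
    {z : EuclideanSpace 𝕜 (Fin n)} (hz : z ∈ polydisc 𝕜 n s) :
    (p + q).sum z = p.sum z + q.sum z := by
  rw [sum, sum, sum, ← (summable_norm_of_mem_polydisc hp hz).of_norm.tsum_add
    (summable_norm_of_mem_polydisc hq hz).of_norm]
  simp [add_mul]

theorem sum_mul {s : ℕ} {p q : MvPowerSeries (Fin n) 𝕜} (hp : wnorm s p ≠ ⊤) (hq : wnorm s q ≠ ⊤)
    {z : EuclideanSpace 𝕜 (Fin n)} (hz : z ∈ polydisc 𝕜 n s) :
    (p * q).sum z = p.sum z * q.sum z := by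
  classical
  have h1 := summable_norm_of_mem_polydisc hp hz
  have h2 := summable_norm_of_mem_polydisc hq hz
  have h := h1.of_norm.tsum_mul_tsum_eq_tsum_sum_antidiagonal h2.of_norm
    (summable_mul_of_summable_norm (f := fun α => coeff α p * mon z α)
      (g := fun α => coeff α q * mon z α) h1 h2)
  refine Eq.trans (tsum_congr fun α => ?_) h.symm
  rw [coeff_mul, Finset.sum_mul]
  refine Finset.sum_congr rfl fun x hx => ?_
  rw [← Finset.HasAntidiagonal.mem_antidiagonal.1 hx, mon_add]
  exact mul_mul_mul_comm _ _ _ _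

theorem sum_X (i : Fin n) (z : EuclideanSpace 𝕜 (Fin n)) :
    (X i : MvPowerSeries (Fin n) 𝕜).sum z = z i := by
  classical
  rw [sum, tsum_eq_single (Finsupp.single i 1), coeff_index_single_self_X, one_mul, mon_single]
  intro β hβ
  rw [coeff_X, if_neg hβ, zero_mul]

theorem sum_zero (z : EuclideanSpace 𝕜 (Fin n)) : (0 : MvPowerSeries (Fin n) 𝕜).sum z = 0 := by
  simp [sum]

theorem sum_one (z : EuclideanSpace 𝕜 (Fin n)) : (1 : MvPowerSeries (Fin n) 𝕜).sum z = 1 := by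
  classical
  rw [sum, tsum_eq_single 0, coeff_zero_one, one_mul, mon_zero]
  intro β hβ
  rw [coeff_one, if_neg hβ, zero_mul]

end MvPowerSeries

section mon

variable {𝕜 : Type*} [RCLike 𝕜] {n : ℕ}

theorem mon_eq_prod_erase_mul (z : EuclideanSpace 𝕜 (Fin n)) (i : Fin n) (α : Fin n →₀ ℕ) :
    mon z α = (∏ j ∈ Finset.univ.erase i, z j ^ α j) * z i ^ α i :=
  (Finset.prod_erase_mul _ _ (Finset.mem_univ i)).symm

theorem mon_add_smul_single (z : EuclideanSpace 𝕜 (Fin n)) (i : Fin n) (t : 𝕜)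
    (α : Fin n →₀ ℕ) : mon (z + t • EuclideanSpace.single i 1) α =
      (∏ j ∈ Finset.univ.erase i, z j ^ α j) * (z i + t) ^ α i := by
  rw [mon_eq_prod_erase_mul _ i]
  congr 1
  · refine Finset.prod_congr rfl fun j hj => ?_
    simp [Finset.ne_of_mem_erase hj]
  · simp

theorem add_smul_single_mem_polydisc {s : ℕ} {z : EuclideanSpace 𝕜 (Fin n)}
    (hz : z ∈ polydisc 𝕜 n s) {i : Fin n} {t : 𝕜}
    (ht : ‖z i + t‖ₑ ≤ wt s (Finsupp.single i 1)) :
    z + t • EuclideanSpace.single i 1 ∈ polydisc 𝕜 n s := by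
  intro j
  by_cases h : j = i
  · subst h
    simpa using ht
  · simpa [h] using hz j

/-- The derivative of a monomial along the `i`-th coordinate. -/
def dmon (i : Fin n) (z : EuclideanSpace 𝕜 (Fin n)) (α : Fin n →₀ ℕ) : 𝕜 :=
  (∏ j ∈ Finset.univ.erase i, z j ^ α j) * (α i * z i ^ (α i - 1))

theorem hasDerivAt_mon (i : Fin n) (z : EuclideanSpace 𝕜 (Fin n)) (α : Fin n →₀ ℕ) (t : 𝕜) :
    HasDerivAt (fun t : 𝕜 => mon (z + t • EuclideanSpace.single i 1) α)
      (dmon i (z + t • EuclideanSpace.single i 1) α) t := by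
  simp only [mon_add_smul_single]
  have := ((hasDerivAt_id t).const_add (z i)).pow (α i) |>.const_mul
    (∏ j ∈ Finset.univ.erase i, z j ^ α j)
  have h : dmon i (z + t • EuclideanSpace.single i 1) α = (∏ j ∈ Finset.univ.erase i, z j ^ α j) *
      (α i * (z i + t) ^ (α i - 1) * 1) := by
    rw [dmon]
    congr 1
    · refine Finset.prod_congr rfl fun j hj => ?_
      simp [Finset.ne_of_mem_erase hj]
    · simp
  rw [h]
  exact this

theorem dmon_eq_zero {i : Fin n} (z : EuclideanSpace 𝕜 (Fin n)) {α : Fin n →₀ ℕ} (h : α i = 0) :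
    dmon i z α = 0 := by simp [dmon, h]

theorem dmon_add_single (i : Fin n) (z : EuclideanSpace 𝕜 (Fin n)) (α : Fin n →₀ ℕ) :
    dmon i z (α + Finsupp.single i 1) = (α i + 1) * mon z α := by
  rw [mon_eq_prod_erase_mul z i, dmon, mul_left_comm]
  congr 1
  · simp
  · congr 1
    · refine Finset.prod_congr rfl fun j hj => ?_
      simp [Finset.ne_of_mem_erase hj]
    · simp

theorem mem_range_add_single {i : Fin n} {α : Fin n →₀ ℕ} (h : α i ≠ 0) :
    ∃ γ, γ + Finsupp.single i 1 = α :=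
  ⟨α - Finsupp.single i 1, tsub_add_cancel_of_le
    (Finsupp.single_le_iff.2 (Nat.one_le_iff_ne_zero.2 h))⟩

theorem enorm_dmon_le (i : Fin n) {s : ℕ} {z : EuclideanSpace 𝕜 (Fin n)}
    (hz : z ∈ polydisc 𝕜 n (s + 1)) (α : Fin n →₀ ℕ) :
    ‖dmon i z α‖ₑ ≤ wt s α * (expWeight (Finsupp.single i 1) : ℝ≥0∞) ^ (s + 1) := by
  by_cases h : α i = 0
  · simp [dmon_eq_zero z h]
  obtain ⟨γ, rfl⟩ := mem_range_add_single h
  have h1 : ‖(γ i + 1 : 𝕜)‖ₑ ≤ (expWeight (γ + Finsupp.single i 1) : ℝ≥0∞) := by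
    have h2 := (lt_expWeight (γ + Finsupp.single i 1) i).le
    rw [Finsupp.add_apply, Finsupp.single_eq_same] at h2
    rw [← Nat.cast_add_one, ← ofReal_norm, RCLike.norm_natCast, ENNReal.ofReal_natCast]
    exact_mod_cast h2
  rw [dmon_add_single, enorm_mul]
  calc _ ≤ (expWeight (γ + Finsupp.single i 1) : ℝ≥0∞) * wt (s + 1) γ := by
        gcongr
        exact enorm_mon_le hz γ
    _ = _ := by
      rw [← wt_add_mul (s + 1) γ (Finsupp.single i 1), ← wt_succ s (γ + Finsupp.single i 1)]
      ring

end mon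

namespace MvPowerSeries

variable {𝕜 : Type*} [RCLike 𝕜] {n : ℕ}

theorem tsum_coeff_mul_dmon (p : MvPowerSeries (Fin n) 𝕜) (i : Fin n)
    (z : EuclideanSpace 𝕜 (Fin n)) :
    ∑' α, coeff α p * dmon i z α = (pderiv 𝕜 i p).sum z := by
  rw [sum, ← (add_left_injective (Finsupp.single i 1)).tsum_eq]
  · refine tsum_congr fun γ => ?_
    simp only [dmon_add_single, coeff_pderiv]
    ring
  · intro α hα
    refine mem_range_add_single fun h => hα ?_
    simp [dmon_eq_zero z h]

theorem hasDerivAt_sum {s : ℕ} {p : MvPowerSeries (Fin n) 𝕜} (hp : wnorm s p ≠ ⊤) (i : Fin n)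
    {z : EuclideanSpace 𝕜 (Fin n)} (hz : z ∈ polydisc 𝕜 n (s + 1))
    (hzi : ‖z i‖ₑ < wt (s + 1) (Finsupp.single i 1)) :
    HasDerivAt (fun t : 𝕜 => p.sum (z + t • EuclideanSpace.single i 1))
      ((pderiv 𝕜 i p).sum z) 0 := by
  set ρ := (wt (s + 1) (Finsupp.single i 1)).toReal with hρ
  have hmem : ∀ t ∈ Metric.ball (-z i) ρ,
      z + t • EuclideanSpace.single i 1 ∈ polydisc 𝕜 n (s + 1) := fun t ht => by
    refine add_smul_single_mem_polydisc hz ?_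
    rw [← ENNReal.toReal_le_toReal enorm_ne_top (wt_ne_top _ _), toReal_enorm]
    rw [mem_ball_iff_norm, sub_neg_eq_add, add_comm] at ht
    exact ht.le
  have h0 : (0 : 𝕜) ∈ Metric.ball (-z i) ρ := by
    rw [mem_ball_iff_norm, zero_sub, neg_neg, ← toReal_enorm]
    exact (ENNReal.toReal_lt_toReal enorm_ne_top (wt_ne_top _ _)).2 hzi
  have hu : Summable fun α => (‖coeff α p‖ₑ * wt s α *
      (expWeight (Finsupp.single i 1) : ℝ≥0∞) ^ (s + 1)).toReal := by
    refine ENNReal.summable_toReal ?_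
    rw [ENNReal.tsum_mul_right]
    exact ENNReal.mul_ne_top hp (ENNReal.pow_ne_top (ENNReal.natCast_ne_top _))
  have := hasDerivAt_tsum_of_isPreconnected
    (g := fun α (t : 𝕜) => coeff α p * mon (z + t • EuclideanSpace.single i 1) α)
    (g' := fun α (t : 𝕜) => coeff α p * dmon i (z + t • EuclideanSpace.single i 1) α)
    hu Metric.isOpen_ball ((convex_ball (-z i) ρ).isPreconnected)
    (fun α t _ => (hasDerivAt_mon i z α t).const_mul _) (fun α t ht => ?_) h0
    (summable_norm_of_mem_polydisc hp (polydisc_anti (Nat.le_succ s) (hmem 0 h0))).of_norm h0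
  · simp only [tsum_coeff_mul_dmon, zero_smul, add_zero] at this
    exact this
  · rw [← toReal_enorm]
    refine ENNReal.toReal_mono (ENNReal.mul_ne_top (ENNReal.mul_ne_top enorm_ne_top
      (wt_ne_top _ _)) (ENNReal.pow_ne_top (ENNReal.natCast_ne_top _))) ?_
    rw [enorm_mul, mul_assoc]
    gcongr
    exact enorm_dmon_le i (hmem t ht) α

end MvPowerSeries

section words

variable {𝕜 : Type*} [RCLike 𝕜] {n : ℕ}

/-- The exponent of the product of the coordinates indexed by the letters of a word. -/
noncomputable def wordExp (x : Σ d, Fin d → Fin n) : Fin n →₀ ℕ :=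
  ∑ k, Finsupp.single (x.2 k) 1

theorem mon_wordExp (z : EuclideanSpace 𝕜 (Fin n)) (x : Σ d, Fin d → Fin n) :
    mon z (wordExp x) = ∏ k, z (x.2 k) := by
  rw [wordExp]
  generalize (Finset.univ : Finset (Fin x.1)) = t
  classical
  induction t using Finset.induction_on with
  | empty => simp [mon_zero]
  | insert k t hk ih => rw [Finset.sum_insert hk, Finset.prod_insert hk, mon_add, mon_single, ih]

theorem wt_wordExp_le (s : ℕ) (x : Σ d, Fin d → Fin n) :
    wt s (wordExp x) ≤ ((2 ^ s)⁻¹ : ℝ≥0∞) ^ x.1 := by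
  have : ∀ t : Finset (Fin x.1), wt s (∑ k ∈ t, Finsupp.single (x.2 k) 1) ≤
      ((2 ^ s)⁻¹ : ℝ≥0∞) ^ t.card := fun t => by
    classical
    induction t using Finset.induction_on with
    | empty => simp [wt_zero]
    | insert k t hk ih =>
      rw [Finset.sum_insert hk, Finset.card_insert_of_notMem hk, wt_add, pow_succ, mul_comm]
      exact mul_le_mul' ih (wt_single_le s _)
  simpa [wordExp] using this Finset.univ

theorem ContinuousMultilinearMap.apply_eq_sum_words {d : ℕ}
    (L : ContinuousMultilinearMap 𝕜 (fun _ : Fin d => EuclideanSpace 𝕜 (Fin n)) 𝕜)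
    (z : EuclideanSpace 𝕜 (Fin n)) :
    L (fun _ => z) = ∑ v : Fin d → Fin n,
      L (fun k => EuclideanSpace.single (v k) 1) * ∏ k, z (v k) := by
  have hz : z = ∑ i, z i • EuclideanSpace.single i (1 : 𝕜) := by
    ext j
    simp [Finset.sum_apply, Pi.single_apply]
  conv_lhs => rw [hz]
  rw [L.map_sum]
  refine Finset.sum_congr rfl fun v _ => ?_
  rw [L.map_smul_univ (fun k => z (v k)) (fun k => EuclideanSpace.single (v k) 1), smul_eq_mul,
    mul_comm]

theorem exists_tsum_words_ne_top {P : FormalMultilinearSeries 𝕜 (EuclideanSpace 𝕜 (Fin n)) 𝕜}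
    (hP : 0 < P.radius) : ∃ s, ∑' x : Σ d, Fin d → Fin n,
      ‖P x.1 (fun k => EuclideanSpace.single (x.2 k) 1)‖ₑ * wt s (wordExp x) ≠ ⊤ := by
  obtain ⟨r, hr0, hr⟩ := ENNReal.lt_iff_exists_nnreal_btwn.1 hP
  obtain ⟨C, -, hC⟩ := P.nnnorm_mul_pow_le_of_lt_radius hr
  have hr0' : r ≠ 0 := by simpa [pos_iff_ne_zero] using hr0
  obtain ⟨N, hN⟩ := ENNReal.exists_nat_gt (r := (n : ℝ≥0∞) * (r : ℝ≥0∞)⁻¹)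
    (ENNReal.mul_ne_top (ENNReal.natCast_ne_top _) (ENNReal.inv_ne_top.2 (by simpa)))
  refine ⟨N + 1, ?_⟩
  set b : ℝ≥0∞ := (r : ℝ≥0∞)⁻¹ * (2 ^ (N + 1))⁻¹ with hb
  have hnb : n * b ≤ 2⁻¹ := by
    calc n * b = n * (r : ℝ≥0∞)⁻¹ * (2 ^ (N + 1))⁻¹ := by rw [hb, mul_assoc]
      _ ≤ 2 ^ N * (2 ^ (N + 1))⁻¹ := by
        gcongr
        exact hN.le.trans (by exact_mod_cast N.lt_two_pow_self.le)
      _ = 2⁻¹ := by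
        rw [pow_succ, ENNReal.mul_inv (by simp) (by simp), ← mul_assoc,
          ENNReal.mul_inv_cancel (by simp) (by simp), one_mul]
  have hterm : ∀ x : Σ d, Fin d → Fin n,
      ‖P x.1 (fun k => EuclideanSpace.single (x.2 k) 1)‖ₑ * wt (N + 1) (wordExp x) ≤
        C * b ^ x.1 := by
    intro x
    have h1 : ‖P x.1 (fun k => EuclideanSpace.single (x.2 k) 1)‖₊ ≤ ‖P x.1‖₊ := by
      refine ((P x.1).le_opNNNorm _).trans (le_of_eq ?_)
      simp
    have h2 : ‖P x.1‖₊ ≤ C * r⁻¹ ^ x.1 := by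
      rw [inv_pow, ← div_eq_mul_inv, le_div_iff₀ (pow_pos (pos_iff_ne_zero.2 hr0') _)]
      exact hC x.1
    have h3 : ‖P x.1 (fun k => EuclideanSpace.single (x.2 k) 1)‖ₑ ≤
        C * (r : ℝ≥0∞)⁻¹ ^ x.1 := by
      rw [← ENNReal.coe_inv hr0']
      exact_mod_cast h1.trans h2
    calc _ ≤ C * (r : ℝ≥0∞)⁻¹ ^ x.1 * ((2 ^ (N + 1))⁻¹ : ℝ≥0∞) ^ x.1 :=
          mul_le_mul' h3 (wt_wordExp_le _ x)
      _ = _ := by rw [hb, mul_pow, mul_assoc]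
  refine ne_top_of_le_ne_top ?_ (ENNReal.tsum_le_tsum hterm)
  rw [ENNReal.tsum_sigma' (fun x : Σ d, Fin d → Fin n => (C : ℝ≥0∞) * b ^ x.1)]
  have : ∀ d, ∑' _v : Fin d → Fin n, (C : ℝ≥0∞) * b ^ d = C * (n * b) ^ d := fun d => by
    rw [tsum_fintype, Finset.sum_const, nsmul_eq_mul, mul_pow]
    simp
    ring
  simp only [this]
  rw [ENNReal.tsum_mul_left]
  refine ENNReal.mul_ne_top ENNReal.coe_ne_top (ne_top_of_le_ne_top ?_
    (ENNReal.tsum_le_tsum fun d => pow_le_pow_left' hnb d))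
  rw [ENNReal.tsum_geometric]
  simp

end words

namespace MvPowerSeries

variable {𝕜 : Type*} [RCLike 𝕜] {n : ℕ}

theorem exists_eventuallyEq_sum {f : EuclideanSpace 𝕜 (Fin n) → 𝕜} (hf : AnalyticAt 𝕜 f 0) :
    ∃ p : convergent 𝕜 n, f =ᶠ[𝓝 0] (p : MvPowerSeries (Fin n) 𝕜).sum := by
  obtain ⟨P, r, hP⟩ := hf
  obtain ⟨s, hs⟩ := exists_tsum_words_ne_top (hP.r_pos.trans_le hP.r_le)
  set c : (Σ d, Fin d → Fin n) → 𝕜 := fun x => P x.1 fun k => EuclideanSpace.single (x.2 k) 1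
    with hc
  let E := Equiv.sigmaFiberEquiv (wordExp (n := n))
  let p : MvPowerSeries (Fin n) 𝕜 := fun α => ∑' x : {x // wordExp x = α}, c x
  have hp : wnorm s p ≠ ⊤ := by
    refine ne_top_of_le_ne_top hs ?_
    rw [← E.tsum_eq, ENNReal.tsum_sigma']
    refine ENNReal.tsum_le_tsum fun α => ?_
    calc _ ≤ (∑' x : {x // wordExp x = α}, ‖c x‖ₑ) * wt s α := by
          gcongr
          exact enorm_tsum_le_tsum_enorm
      _ = ∑' x : {x // wordExp x = α}, ‖c x‖ₑ * wt s α := ENNReal.tsum_mul_right.symm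
      _ ≤ _ := ENNReal.tsum_le_tsum fun ⟨x, hx⟩ => by
          subst hx
          exact le_rfl
  refine ⟨⟨p, s, hp⟩, ?_⟩
  filter_upwards [polydisc_mem_nhds s, Metric.eball_mem_nhds 0 hP.r_pos] with z hz hzr
  have hsum : Summable fun x => c x * mon z (wordExp x) := by
    refine Summable.of_norm (tsum_enorm_ne_top_iff_summable_norm.1 (ne_top_of_le_ne_top hs
      (ENNReal.tsum_le_tsum fun x => ?_)))
    rw [enorm_mul]
    gcongr
    exact enorm_mon_le hz _
  have h1 : f z = ∑' x, c x * mon z (wordExp x) := by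
    have := hP.hasSum hzr
    rw [zero_add] at this
    rw [← this.tsum_eq, hsum.tsum_sigma]
    refine tsum_congr fun d => ?_
    rw [tsum_fintype, ContinuousMultilinearMap.apply_eq_sum_words]
    simp only [mon_wordExp, hc]
  rw [h1, ← E.tsum_eq]
  refine ((E.summable_iff).2 hsum).tsum_sigma.trans ?_
  refine tsum_congr fun α => ?_
  have h2 : coeff α p = ∑' x : {x // wordExp x = α}, c x := rfl
  rw [h2, ← tsum_mul_right]
  refine tsum_congr fun ⟨x, hx⟩ => ?_
  subst hx
  rfl

end MvPowerSeries

open Asymptotics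

namespace MvPowerSeries

namespace convergent

variable {𝕜 : Type*} [RCLike 𝕜] {n : ℕ}

/-- The sum of a convergent power series, as a function germ at the origin. -/
noncomputable def toFun (p : convergent 𝕜 n) : EuclideanSpace 𝕜 (Fin n) → 𝕜 :=
  (p : MvPowerSeries (Fin n) 𝕜).sum

theorem toFun_add (p q : convergent 𝕜 n) : toFun (p + q) =ᶠ[𝓝 0] toFun p + toFun q := by
  obtain ⟨s, hs⟩ := p.2
  obtain ⟨t, ht⟩ := q.2
  filter_upwards [polydisc_mem_nhds (max s t)] with z hz
  exact sum_add (ne_top_of_le_ne_top hs (wnorm_anti (le_max_left s t) _))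
    (ne_top_of_le_ne_top ht (wnorm_anti (le_max_right s t) _)) hz

theorem toFun_mul (p q : convergent 𝕜 n) : toFun (p * q) =ᶠ[𝓝 0] toFun p * toFun q := by
  obtain ⟨s, hs⟩ := p.2
  obtain ⟨t, ht⟩ := q.2
  filter_upwards [polydisc_mem_nhds (max s t)] with z hz
  exact sum_mul (ne_top_of_le_ne_top hs (wnorm_anti (le_max_left s t) _))
    (ne_top_of_le_ne_top ht (wnorm_anti (le_max_right s t) _)) hz

theorem toFun_zero : toFun (0 : convergent 𝕜 n) = 0 := funext sum_zero

theorem toFun_one : toFun (1 : convergent 𝕜 n) = 1 := funext sum_one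

theorem toFun_pow (p : convergent 𝕜 n) (k : ℕ) : toFun (p ^ k) =ᶠ[𝓝 0] toFun p ^ k := by
  induction k with
  | zero => simp [toFun_one]
  | succ k ih =>
    rw [pow_succ, pow_succ]
    exact (toFun_mul _ _).trans (ih.mul EventuallyEq.rfl)

theorem toFun_isBigO_one (p : convergent 𝕜 n) : toFun p =O[𝓝 0] (1 : EuclideanSpace 𝕜 (Fin n) → ℝ) := by
  obtain ⟨s, hs⟩ := p.2
  refine IsBigO.of_bound (wnorm s (p : MvPowerSeries (Fin n) 𝕜)).toReal ?_
  filter_upwards [polydisc_mem_nhds s] with z hz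
  simpa [toFun] using norm_sum_le hs hz

theorem toFun_zero_eq (p : convergent 𝕜 n) : toFun p 0 = constantCoeff 𝕜 n p := by
  rw [toFun, MvPowerSeries.sum, tsum_eq_single 0, mon_zero, mul_one, constantCoeff_apply]
  intro α hα
  obtain ⟨i, hi⟩ := DFunLike.ne_iff.1 hα
  rw [mon, Finset.prod_eq_zero (Finset.mem_univ i), mul_zero]
  simpa using hi

/-- The ideal of convergent power series that are `O(φ)` at the origin. -/
def bigOIdeal (φ : EuclideanSpace 𝕜 (Fin n) → ℝ) : Ideal (convergent 𝕜 n) where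
  carrier := {p | toFun p =O[𝓝 0] φ}
  add_mem' hp hq := (IsBigO.add hp hq).congr' (toFun_add _ _).symm EventuallyEq.rfl
  zero_mem' := by
    rw [Set.mem_ofPred_eq, toFun_zero]
    exact isBigO_zero _ _
  smul_mem' p q hq := by
    simpa using ((toFun_isBigO_one p).mul hq).congr' (toFun_mul p q).symm EventuallyEq.rfl

theorem mem_bigOIdeal {φ : EuclideanSpace 𝕜 (Fin n) → ℝ} {p : convergent 𝕜 n} :
    p ∈ bigOIdeal φ ↔ toFun p =O[𝓝 0] φ := Iff.rfl

/-- The ideal of convergent power series that are `o(φ)` at the origin. -/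
def littleOIdeal (φ : EuclideanSpace 𝕜 (Fin n) → ℝ) : Ideal (convergent 𝕜 n) where
  carrier := {p | toFun p =o[𝓝 0] φ}
  add_mem' hp hq := (IsLittleO.add hp hq).congr' (toFun_add _ _).symm EventuallyEq.rfl
  zero_mem' := by
    rw [Set.mem_ofPred_eq, toFun_zero]
    exact isLittleO_zero _ _
  smul_mem' p q hq := by
    simpa using ((toFun_isBigO_one p).mul_isLittleO hq).congr' (toFun_mul p q).symm
      EventuallyEq.rfl

theorem bigOIdeal_mul_le (φ ψ : EuclideanSpace 𝕜 (Fin n) → ℝ) :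
    bigOIdeal φ * bigOIdeal ψ ≤ bigOIdeal (φ * ψ) :=
  Ideal.mul_le.2 fun p hp q hq =>
    (IsBigO.mul hp hq).congr' (toFun_mul p q).symm EventuallyEq.rfl

theorem bigOIdeal_pow_le (φ : EuclideanSpace 𝕜 (Fin n) → ℝ) (k : ℕ) :
    bigOIdeal φ ^ k ≤ bigOIdeal (φ ^ k) := by
  induction k with
  | zero => exact fun p _ => by simpa [mem_bigOIdeal] using toFun_isBigO_one p
  | succ k ih =>
    rw [pow_succ, pow_succ]
    exact (Ideal.mul_mono_left ih).trans (bigOIdeal_mul_le _ _)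

theorem littleOIdeal_mul_bigOIdeal_le (φ ψ : EuclideanSpace 𝕜 (Fin n) → ℝ) :
    littleOIdeal φ * bigOIdeal ψ ≤ littleOIdeal (φ * ψ) :=
  Ideal.mul_le.2 fun p hp q hq =>
    (IsLittleO.mul_isBigO hp hq).congr' (toFun_mul p q).symm EventuallyEq.rfl

theorem maximalIdeal_le_littleOIdeal :
    IsLocalRing.maximalIdeal (convergent 𝕜 n) ≤ littleOIdeal 1 := by
  rw [maximalIdeal_eq_span, Ideal.span_le]
  rintro _ ⟨i, rfl⟩
  have h : toFun (X i : convergent 𝕜 n) = fun z => z i := funext fun z => sum_X i z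
  have hc : Continuous fun z : EuclideanSpace 𝕜 (Fin n) => z i := by fun_prop
  change toFun _ =o[𝓝 0] (fun _ => (1 : ℝ))
  rw [h, isLittleO_one_iff]
  simpa using hc.tendsto 0

theorem eventually_fderiv_eq {f : EuclideanSpace 𝕜 (Fin n) → 𝕜} (hf : AnalyticAt 𝕜 f 0)
    {p : convergent 𝕜 n} (hp : f =ᶠ[𝓝 0] toFun p) (i : Fin n) :
    ∀ᶠ z in 𝓝 0, fderiv 𝕜 f z (EuclideanSpace.single i 1) = toFun (pderiv i p) z := by
  obtain ⟨s, hs⟩ := p.2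
  filter_upwards [hp.eventuallyEq_nhds, hf.eventually_analyticAt, polydisc_mem_nhds (s + 2)]
    with z hz hfz hzs
  have hlt : wt (s + 2) (Finsupp.single i 1) < wt (s + 1) (Finsupp.single i 1) := by
    rw [← wt_succ (s + 1)]
    conv_lhs => rw [← mul_one (wt _ _)]
    refine ENNReal.mul_lt_mul_right (wt_ne_zero _ _) (wt_ne_top _ _) ?_
    have := lt_expWeight (Finsupp.single i 1) i
    rw [Finsupp.single_eq_same] at this
    exact_mod_cast this
  have h1 := hasDerivAt_sum hs i (polydisc_anti (Nat.le_succ _) hzs) ((hzs i).trans_lt hlt)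
  have hline : HasDerivAt (fun t : 𝕜 => z + t • EuclideanSpace.single i (1 : 𝕜))
      (EuclideanSpace.single i 1) 0 := by
    simpa using ((hasDerivAt_id (0 : 𝕜)).smul_const (EuclideanSpace.single i (1 : 𝕜))).const_add z
  have hline0 : z + (0 : 𝕜) • EuclideanSpace.single i (1 : 𝕜) = z := by simp
  have h2 := HasFDerivAt.comp_hasDerivAt (0 : 𝕜) (l := f)
    (by rw [hline0]; exact hfz.differentiableAt.hasFDerivAt) hline
  have ht : Tendsto (fun t : 𝕜 => z + t • EuclideanSpace.single i (1 : 𝕜)) (𝓝 0) (𝓝 z) := by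
    simpa using hline.continuousAt.tendsto
  exact (h2.congr_of_eventuallyEq (EventuallyEq.symm (ht.eventually hz))).unique h1

end convergent

end MvPowerSeries

section gradient

open MvPowerSeries convergent

variable {𝕜 : Type*} [RCLike 𝕜] {n : ℕ}

/-- The weak Łojasiewicz gradient inequality. -/
theorem AnalyticAt.eventually_norm_le_norm_fderiv {f : EuclideanSpace 𝕜 (Fin n) → 𝕜}
    (hf : AnalyticAt 𝕜 f 0) (hf0 : f 0 = 0) : ∀ᶠ z in 𝓝 0, ‖f z‖ ≤ ‖fderiv 𝕜 f z‖ := by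
  obtain ⟨p, hp : f =ᶠ[𝓝 0] toFun p⟩ := exists_eventuallyEq_sum hf
  by_cases hp0 : p = 0
  · subst hp0
    filter_upwards [hp] with z hz
    simp [hz, toFun_zero]
  have hpc : MvPowerSeries.convergent.constantCoeff 𝕜 n p = 0 := by
    rw [← toFun_zero_eq, ← hp.eq_of_nhds, hf0]
  obtain ⟨k, hk⟩ := exists_pow_mem hp0 hpc
  let M : EuclideanSpace 𝕜 (Fin n) → ℝ := fun z => max ‖f z‖ ‖fderiv 𝕜 f z‖
  have hle : Ideal.span (Set.range fun i => convergent.pderiv i p) ⊔ Ideal.span {p} ≤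
      bigOIdeal M := by
    refine sup_le (Ideal.span_le.2 ?_) (Ideal.span_le.2 (Set.singleton_subset_iff.2 ?_))
    · rintro _ ⟨i, rfl⟩
      refine IsBigO.of_bound 1 ?_
      filter_upwards [eventually_fderiv_eq hf hp i] with z hz
      rw [← hz, one_mul]
      refine ((fderiv 𝕜 f z).le_opNorm _).trans ?_
      simpa [M] using (le_max_right _ _).trans (le_abs_self _)
    · refine IsBigO.of_bound 1 ?_
      filter_upwards [hp] with z hz
      rw [← hz, one_mul]
      exact (le_max_left _ _).trans (le_abs_self _)
  have hmem : toFun (p ^ k) =o[𝓝 0] (1 * M ^ k) :=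
    littleOIdeal_mul_bigOIdeal_le _ _ (Ideal.mul_mono maximalIdeal_le_littleOIdeal
      ((Ideal.pow_right_mono hle k).trans (bigOIdeal_pow_le M k)) hk)
  filter_upwards [hmem.bound (c := 1 / 2) (by norm_num), hp, toFun_pow p k] with z h1 h2 h3
  by_contra! hlt
  have hM : M z = ‖f z‖ := max_eq_left hlt.le
  rw [h3, one_mul, Pi.pow_apply, Pi.pow_apply, hM, ← h2, norm_pow, norm_pow, norm_norm] at h1
  have : 0 < ‖f z‖ ^ k := pow_pos ((norm_nonneg _).trans_lt hlt) k
  linarith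

end gradient

section exponent

variable {𝕜 : Type*} [RCLike 𝕜]

/-- The exponents for which the Łojasiewicz gradient inequality holds near the origin. -/
def gradientExponents {E : Type*} [NormedAddCommGroup E] [NormedSpace 𝕜 E] (f : E → 𝕜) : Set ℝ :=
  {l | 0 < l ∧ ∃ c > (0 : ℝ), ∀ᶠ z in 𝓝 0, c * ‖f z‖ ^ l ≤ ‖fderiv 𝕜 f z‖}

theorem LGE_eq_sInf_gradientExponents {E : Type*} [NormedAddCommGroup E] [NormedSpace 𝕜 E]
    (f : E → 𝕜) : LGE f = sInf (gradientExponents f) := by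
  simp only [LGE, gradientExponents, Metric.eventually_nhds_iff, dist_zero_right]

theorem gradientExponents_congr {E : Type*} [NormedAddCommGroup E] [NormedSpace 𝕜 E]
    {f g : E → 𝕜} (h : f =ᶠ[𝓝 0] g) : gradientExponents f ⊆ gradientExponents g := by
  rintro l ⟨hl, c, hc, hev⟩
  refine ⟨hl, c, hc, ?_⟩
  filter_upwards [hev, h, h.fderiv (𝕜 := 𝕜)] with z h1 h2 h3
  rwa [← h2, ← h3]

theorem mem_gradientExponents_mul {E : Type*} [NormedAddCommGroup E] [NormedSpace 𝕜 E]
    {f u : E → 𝕜} (hf : AnalyticAt 𝕜 f 0) (hf0 : f 0 = 0) (hu : AnalyticAt 𝕜 u 0) (hu0 : u 0 ≠ 0)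
    {l : ℝ} (hl1 : l < 1) (hl : l ∈ gradientExponents f) :
    l ∈ gradientExponents fun z => u z * f z := by
  obtain ⟨hl0, c, hc, hev⟩ := hl
  have hu0' : 0 < ‖u 0‖ := norm_pos_iff.2 hu0
  have hU : 0 < ‖u 0‖ + 1 := by positivity
  set m := ‖u 0‖ / 2 with hm
  have hm0 : 0 < m := half_pos hu0'
  refine ⟨hl0, m * c / 2 / (‖u 0‖ + 1) ^ l, by positivity, ?_⟩
  have htend : Tendsto (fun z => (‖fderiv 𝕜 u 0‖ + 1) * ‖f z‖ ^ (1 - l)) (𝓝 0) (𝓝 0) := by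
    have h1 : Tendsto (fun z => ‖f z‖) (𝓝 0) (𝓝 0) := by
      simpa [hf0] using hf.continuousAt.norm.tendsto
    have h2 := (h1.rpow_const (p := 1 - l) (Or.inr (by linarith))).const_mul (‖fderiv 𝕜 u 0‖ + 1)
    rwa [Real.zero_rpow (by linarith), mul_zero] at h2
  filter_upwards [hev, hf.eventually_analyticAt, hu.eventually_analyticAt,
    hu.continuousAt.norm.eventually_lt_const (lt_add_one ‖u 0‖),
    hu.continuousAt.norm.eventually_const_lt (half_lt_self hu0'),
    hu.fderiv.continuousAt.norm.eventually_lt_const (lt_add_one ‖fderiv 𝕜 u 0‖),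
    htend.eventually_lt_const (show 0 < m * c / 2 by positivity)] with z h1 hfz huz h2 h3 h4 h5
  rw [fderiv_fun_mul huz.differentiableAt hfz.differentiableAt]
  have hsplit : ‖f z‖ = ‖f z‖ ^ l * ‖f z‖ ^ (1 - l) := by
    rw [← Real.rpow_add_of_nonneg (norm_nonneg _) hl0.le (by linarith), add_sub_cancel,
      Real.rpow_one]
  have hfl : 0 ≤ ‖f z‖ ^ l := by positivity
  have hlow : m * (c * ‖f z‖ ^ l) ≤ ‖u z • fderiv 𝕜 f z‖ := by
    rw [norm_smul]
    gcongr
  have hup : ‖f z • fderiv 𝕜 u z‖ ≤ m * c / 2 * ‖f z‖ ^ l := by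
    rw [norm_smul]
    calc _ ≤ ‖f z‖ * (‖fderiv 𝕜 u 0‖ + 1) := by gcongr
      _ = ((‖fderiv 𝕜 u 0‖ + 1) * ‖f z‖ ^ (1 - l)) * ‖f z‖ ^ l := by
        conv_lhs => rw [hsplit]
        ring
      _ ≤ _ := by gcongr
  calc _ = m * c / 2 / (‖u 0‖ + 1) ^ l * (‖u z‖ ^ l * ‖f z‖ ^ l) := by
        rw [norm_mul, Real.mul_rpow (norm_nonneg _) (norm_nonneg _)]
    _ ≤ m * c / 2 / (‖u 0‖ + 1) ^ l * ((‖u 0‖ + 1) ^ l * ‖f z‖ ^ l) := by gcongr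
    _ = m * (c * ‖f z‖ ^ l) - m * c / 2 * ‖f z‖ ^ l := by
      field_simp
      ring
    _ ≤ ‖u z • fderiv 𝕜 f z‖ - ‖f z • fderiv 𝕜 u z‖ := by gcongr
    _ ≤ _ := norm_sub_le_norm_add _ _

theorem one_mem_gradientExponents {n : ℕ} {f : EuclideanSpace 𝕜 (Fin n) → 𝕜}
    (hf : AnalyticAt 𝕜 f 0) (hf0 : f 0 = 0) : 1 ∈ gradientExponents f :=
  ⟨one_pos, 1, one_pos, by simpa using hf.eventually_norm_le_norm_fderiv hf0⟩

theorem sInf_gradientExponents_le {n : ℕ} {f g : EuclideanSpace 𝕜 (Fin n) → 𝕜}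
    (hf : 1 ∈ gradientExponents f) (hg : 1 ∈ gradientExponents g)
    (h : ∀ l < 1, l ∈ gradientExponents f → l ∈ gradientExponents g) :
    sInf (gradientExponents g) ≤ sInf (gradientExponents f) := by
  have hb : BddBelow (gradientExponents g) := ⟨0, fun l hl => hl.1.le⟩
  refine le_csInf ⟨1, hf⟩ fun l hl => ?_
  rcases lt_or_ge l 1 with hl1 | hl1
  · exact csInf_le hb (h l hl1 hl)
  · exact (csInf_le hb hg).trans hl1

end exponent

/-- multiplying by an analytic unit does not change the Łojasiewicz gradient
exponent: `ℒ(u·f) = ℒ(f)`. -/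
theorem stmt1 {𝕜 : Type*} [RCLike 𝕜] {n : ℕ} (f u : EuclideanSpace 𝕜 (Fin n) → 𝕜)
    (hf : AnalyticAt 𝕜 f 0) (hf0 : f 0 = 0)
    (hu : AnalyticAt 𝕜 u 0) (hu0 : u 0 ≠ 0) :
    LGE (fun z => u z * f z) = LGE f := by
  have huf : AnalyticAt 𝕜 (fun z => u z * f z) 0 := hu.mul hf
  have huf0 : u 0 * f 0 = 0 := by rw [hf0, mul_zero]
  have h1 := one_mem_gradientExponents hf hf0
  have h2 := one_mem_gradientExponents huf huf0
  rw [LGE_eq_sInf_gradientExponents, LGE_eq_sInf_gradientExponents]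
  refine le_antisymm (sInf_gradientExponents_le h1 h2 fun l hl1 hl =>
    mem_gradientExponents_mul hf hf0 hu hu0 hl1 hl) (sInf_gradientExponents_le h2 h1
      fun l hl1 hl => ?_)
  refine gradientExponents_congr ?_ (mem_gradientExponents_mul huf huf0 (hu.inv hu0)
    (inv_ne_zero hu0) hl1 hl)
  filter_upwards [hu.continuousAt.eventually_ne hu0] with z hz
  exact inv_mul_cancel_left₀ hz (f z)
end

section
/- Let f : (ℂ²,0) → (ℂ,0) be a Weierstrass polynomial of degree m ≥ 1 in x of the form f(x,y) = x^m + a_1(y)x^{m-1} + ⋯ + a_m(y) with a_i(0)=0, and suppose every Newton–Puiseux root of ∂f/∂x = 0 is also a root of f = 0. Then there exists φ ∈ ℂ{y} with φ(0) = 0 such that f(x,y) = (x - φ(y))^m, and consequently ℒ(f) = (m-1)/m. -/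
open Filter

open Polynomial Topology ContDiff

/-- A one-parameter family of complex polynomials of bounded degree whose coefficients are analytic
at the origin. -/
structure IsAnalyticFamily (n : ℕ) (P : ℂ → ℂ[X]) : Prop where
  natDegree_le : ∀ t, (P t).natDegree ≤ n
  analyticAt_coeff : ∀ i, AnalyticAt ℂ (fun t => (P t).coeff i) 0

namespace IsAnalyticFamily

variable {n : ℕ} {P : ℂ → ℂ[X]}

theorem hasseDeriv (hP : IsAnalyticFamily n P) (j : ℕ) :
    IsAnalyticFamily n (fun t => Polynomial.hasseDeriv j (P t)) where
  natDegree_le t := ((natDegree_hasseDeriv_le _ _).trans (Nat.sub_le _ _)).trans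
    (hP.natDegree_le t)
  analyticAt_coeff i := by
    simp only [hasseDeriv_coeff]
    exact analyticAt_const.mul (hP.analyticAt_coeff _)

theorem analyticAt_eval (hP : IsAnalyticFamily n P) {φ : ℂ → ℂ} (hφ : AnalyticAt ℂ φ 0) :
    AnalyticAt ℂ (fun t => (P t).eval (φ t)) 0 := by
  have h : ∀ t, (P t).eval (φ t) = ∑ i ∈ Finset.range (n + 1), (P t).coeff i * φ t ^ i :=
    fun t => eval_eq_sum_range' (Nat.lt_succ_of_le (hP.natDegree_le t)) _
  simp only [h]
  exact Finset.analyticAt_fun_sum _ fun i _ => (hP.analyticAt_coeff i).mul (hφ.pow i)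

theorem taylor (hP : IsAnalyticFamily n P) {φ : ℂ → ℂ} (hφ : AnalyticAt ℂ φ 0) :
    IsAnalyticFamily n (fun t => Polynomial.taylor (φ t) (P t)) where
  natDegree_le t := by simpa using hP.natDegree_le t
  analyticAt_coeff i := by
    simp only [taylor_coeff]
    exact (hP.hasseDeriv i).analyticAt_eval hφ

theorem comp_pow (hP : IsAnalyticFamily n P) {N : ℕ} (hN : N ≠ 0) :
    IsAnalyticFamily n (fun t => P (t ^ N)) where
  natDegree_le t := hP.natDegree_le _
  analyticAt_coeff i := by
    refine AnalyticAt.fun_comp (g := fun t => (P t).coeff i) ?_ (analyticAt_id.pow N)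
    simpa [hN] using hP.analyticAt_coeff i

theorem divByMonic (hP : IsAnalyticFamily n P) {φ : ℂ → ℂ} (hφ : AnalyticAt ℂ φ 0) :
    IsAnalyticFamily n (fun t => P t /ₘ (X - C (φ t))) where
  natDegree_le t := by
    rw [natDegree_divByMonic _ (monic_X_sub_C _)]
    exact (Nat.sub_le _ _).trans (hP.natDegree_le t)
  analyticAt_coeff i := by
    have h : ∀ t, (P t /ₘ (X - C (φ t))).coeff i =
        ∑ j ∈ Finset.Icc (i + 1) n, φ t ^ (j - (i + 1)) * (P t).coeff j := by
      intro t
      rw [coeff_divByMonic_X_sub_C]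
      refine Finset.sum_subset (Finset.Icc_subset_Icc_right (hP.natDegree_le t)) fun j hj hj' => ?_
      rw [coeff_eq_zero_of_natDegree_lt, mul_zero]
      simp only [Finset.mem_Icc] at hj hj'
      omega
    simp only [h]
    exact Finset.analyticAt_fun_sum _ fun j _ => (hφ.pow _).mul (hP.analyticAt_coeff j)

/-- The implicit function theorem at a simple root. -/
theorem exists_root_of_simple (hP : IsAnalyticFamily n P) (h0 : (P 0).coeff 0 = 0)
    (h1 : (P 0).coeff 1 ≠ 0) :
    ∃ φ : ℂ → ℂ, AnalyticAt ℂ φ 0 ∧ φ 0 = 0 ∧ ∀ᶠ t in 𝓝 0, (P t).eval (φ t) = 0 := by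
  set G : ℂ × ℂ → ℂ := fun p => (P p.1).eval p.2 with hG
  have hGs : ∀ p, G p = ∑ i ∈ Finset.range (n + 1), (P p.1).coeff i * p.2 ^ i :=
    fun p => eval_eq_sum_range' (Nat.lt_succ_of_le (hP.natDegree_le _)) _
  have hGan : AnalyticAt ℂ G 0 := by
    rw [show G = fun p => _ from funext hGs]
    refine Finset.analyticAt_fun_sum _ fun i _ => AnalyticAt.mul ?_ (analyticAt_snd.pow i)
    exact AnalyticAt.fun_comp (g := fun t => (P t).coeff i) (hP.analyticAt_coeff i) analyticAt_fst
  have hcd : ContDiffAt ℂ ω G 0 := hGan.contDiffAt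
  have hder : (fderiv ℂ G 0 ∘L .inr ℂ ℂ ℂ) 1 = (P 0).coeff 1 := by
    have e1 : HasFDerivAt (fun x : ℂ => G (0, x)) (fderiv ℂ G 0 ∘L .inr ℂ ℂ ℂ) 0 :=
      HasFDerivAt.comp (g := G) (f := fun x : ℂ => ((0 : ℂ), x)) 0
        (hGan.differentiableAt.hasFDerivAt) (hasFDerivAt_prodMk_right 0 0)
    have e2 : HasDerivAt (fun x : ℂ => G (0, x)) ((P 0).derivative.eval 0) 0 :=
      (P 0).hasDerivAt 0
    rw [e1.hasDerivAt.unique e2, ← coeff_zero_eq_eval_zero, coeff_derivative]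
    simp
  have hinv : (fderiv ℂ G 0 ∘L .inr ℂ ℂ ℂ).IsInvertible := by
    refine ⟨ContinuousLinearEquiv.unitsEquivAut ℂ (Units.mk0 _ h1), ?_⟩
    ext
    simpa using hder.symm
  have hω : (ω : WithTop ℕ∞) ≠ 0 := by simp
  refine ⟨hcd.implicitFunction hω hinv, ?_, hcd.implicitFunction_apply_self hω hinv, ?_⟩
  · exact (hcd.contDiffAt_implicitFunction hω hinv).analyticAt
  · filter_upwards [hcd.eventually_apply_implicitFunction hω hinv] with t ht
    have : G 0 = 0 := by simpa [hG, coeff_zero_eq_eval_zero] using h0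
    exact ht.trans this

end IsAnalyticFamily

/-- The steepest edge of the Newton polygon: after a ramified substitution `t = s ^ e`, the
coefficients `a i` become divisible by `s ^ (o * (k - i))`, sharply for at least one index. -/
theorem exists_newton_edge {k : ℕ} {a : ℕ → ℂ → ℂ} (ha : ∀ i < k, AnalyticAt ℂ (a i) 0)
    (ha0 : ∀ i < k, a i 0 = 0) (hne : ∃ i < k, ¬ ∀ᶠ t in 𝓝 0, a i t = 0) :
    ∃ e o : ℕ, e ≠ 0 ∧ o ≠ 0 ∧ ∃ g : ℕ → ℂ → ℂ, (∀ i < k, AnalyticAt ℂ (g i) 0) ∧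
      (∀ i < k, ∀ᶠ s in 𝓝 0, a i (s ^ e) = s ^ (o * (k - i)) * g i s) ∧
      ∃ i < k, g i 0 ≠ 0 := by
  classical
  set S := {i ∈ Finset.range k | ¬ ∀ᶠ t in 𝓝 0, a i t = 0} with hS
  have hSne : S.Nonempty := by
    obtain ⟨i, hi, h⟩ := hne
    exact ⟨i, by simp [hS, hi]; simpa using h⟩
  have hfac : ∀ i, ∃ (d : ℕ) (u : ℂ → ℂ), i ∈ S → AnalyticAt ℂ u 0 ∧ u 0 ≠ 0 ∧
      ∀ᶠ t in 𝓝 0, a i t = t ^ d * u t := by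
    intro i
    by_cases hi : i ∈ S
    · obtain ⟨hik, hi0⟩ := Finset.mem_filter.1 hi
      obtain ⟨d, u, hu⟩ :=
        (ha i (Finset.mem_range.1 hik)).exists_eventuallyEq_pow_smul_nonzero_iff.2 hi0
      exact ⟨d, u, fun _ => by simpa using hu⟩
    · exact ⟨0, 0, fun h => absurd h hi⟩
  choose d u hu using hfac
  obtain ⟨j, hjS, hj⟩ := S.exists_min_image (fun i => (d i : ℚ) / ((k - i : ℕ) : ℚ)) hSne
  have hjk : j < k := Finset.mem_range.1 (Finset.mem_filter.1 hjS).1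
  have hle : ∀ i ∈ S, d j * (k - i) ≤ d i * (k - j) := by
    intro i hi
    have hik : i < k := Finset.mem_range.1 (Finset.mem_filter.1 hi).1
    have h := hj i hi
    rw [div_le_div_iff₀ (by exact_mod_cast Nat.sub_pos_of_lt hjk)
      (by exact_mod_cast Nat.sub_pos_of_lt hik)] at h
    exact_mod_cast h
  have he : k - j ≠ 0 := by omega
  have hpow : Tendsto (fun s : ℂ => s ^ (k - j)) (𝓝 0) (𝓝 0) := by
    simpa [he] using (continuous_pow (M := ℂ) (k - j)).tendsto 0
  refine ⟨k - j, d j, he, ?_, fun i s => if i ∈ S then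
    s ^ (d i * (k - j) - d j * (k - i)) * u i (s ^ (k - j)) else 0, ?_, ?_, j, hjk, ?_⟩
  · intro h0
    obtain ⟨-, hu0, hu1⟩ := hu j hjS
    have := hu1.self_of_nhds
    rw [ha0 j hjk, h0] at this
    exact hu0 (by simpa using this.symm)
  · intro i hi
    by_cases hiS : i ∈ S
    · simp only [hiS, if_true]
      refine (analyticAt_id.pow _).mul (AnalyticAt.fun_comp ?_ (analyticAt_id.pow (k - j)))
      simpa [he] using (hu i hiS).1
    · simpa [hiS] using analyticAt_const
  · intro i hi
    by_cases hiS : i ∈ S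
    · filter_upwards [hpow.eventually (hu i hiS).2.2] with s hs
      rw [hs]
      simp only [hiS, if_true]
      rw [← mul_assoc, ← pow_add, Nat.add_sub_cancel' (hle i hiS), ← pow_mul, mul_comm (k - j)]
    · have : ∀ᶠ t in 𝓝 0, a i t = 0 := by
        by_contra h
        exact hiS (Finset.mem_filter.2 ⟨Finset.mem_range.2 hi, h⟩)
      filter_upwards [hpow.eventually this] with s hs
      simp [hiS, hs]
  · simpa [hjS, he] using (hu j hjS).2.1

theorem isAnalyticFamily_sum {n : ℕ} {g : ℕ → ℂ → ℂ} (hg : ∀ i ≤ n, AnalyticAt ℂ (g i) 0) :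
    IsAnalyticFamily n (fun t => ∑ i ∈ Finset.range (n + 1), C (g i t) * X ^ i) where
  natDegree_le t := by
    refine natDegree_sum_le_of_forall_le _ _ fun i hi => ?_
    exact (natDegree_C_mul_X_pow_le _ _).trans (Nat.lt_succ_iff.1 (Finset.mem_range.1 hi))
  analyticAt_coeff i := by
    simp only [finsetSum_coeff, coeff_C_mul_X_pow]
    refine Finset.analyticAt_fun_sum _ fun j hj => ?_
    split_ifs
    · exact hg j (Nat.lt_succ_iff.1 (Finset.mem_range.1 hj))
    · exact analyticAt_const

theorem coeff_sum_range_C_mul_X_pow {R : Type*} [Semiring R] (n : ℕ) (g : ℕ → R) (j : ℕ) :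
    (∑ i ∈ Finset.range (n + 1), C (g i) * X ^ i).coeff j = if j ≤ n then g j else 0 := by
  simp only [finsetSum_coeff, coeff_C_mul_X_pow, Finset.sum_ite_eq, Finset.mem_range,
    Nat.lt_succ_iff]

theorem coeff_X_sub_C_pow_pred {R : Type*} [CommRing R] (a : R) {k : ℕ} (hk : k ≠ 0) :
    ((X - C a) ^ k).coeff (k - 1) = -k * a := by
  rw [sub_eq_add_neg, ← C_neg, coeff_X_add_C_pow, show k - (k - 1) = 1 by omega,
    Nat.choose_symm (by omega : 1 ≤ k), Nat.choose_one_right]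
  ring

/-- A polynomial of degree `k` which is not a multiple of `X ^ k` but has no term of degree `k - 1`
has a root of multiplicity less than `k`. -/
theorem exists_root_multiplicity_lt {p : ℂ[X]} {k i : ℕ} (hdeg : p.natDegree = k)
    (hsub : p.coeff (k - 1) = 0) (hik : i < k) (hi : p.coeff i ≠ 0) :
    ∃ c : ℂ, ∃ l, l ≠ 0 ∧ l < k ∧ (∀ j < l, (taylor c p).coeff j = 0) ∧
      (taylor c p).coeff l ≠ 0 := by
  classical
  obtain ⟨c, hc⟩ := IsAlgClosed.exists_root p (by
    intro h
    have : p.natDegree = 0 := natDegree_eq_of_degree_eq_some h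
    omega)
  have hlead : (taylor c p).coeff k ≠ 0 := by
    rw [← hdeg, ← natDegree_taylor p c, coeff_natDegree]
    simp only [ne_eq, leadingCoeff_eq_zero, taylor_eq_zero]
    rintro rfl
    simp at hi
  have hex : ∃ l, (taylor c p).coeff l ≠ 0 := ⟨k, hlead⟩
  refine ⟨c, Nat.find hex, ?_, ?_, fun j hj => not_not.1 (Nat.find_min hex hj), Nat.find_spec hex⟩
  · intro h0
    have := Nat.find_spec hex
    rw [h0, taylor_coeff_zero] at this
    exact this hc
  · refine lt_of_le_of_ne (Nat.find_min' hex hlead) fun hk => ?_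
    have hmon : taylor c p = C ((taylor c p).coeff k) * X ^ k := by
      ext j
      rw [coeff_C_mul_X_pow]
      rcases lt_trichotomy j k with h | h | h
      · rw [if_neg h.ne]
        exact not_not.1 (Nat.find_min hex (hk ▸ h))
      · rw [if_pos h, h]
      · rw [if_neg h.ne', coeff_eq_zero_of_natDegree_lt]
        rwa [natDegree_taylor, hdeg]
    have hp : p = C ((taylor c p).coeff k) * (X - C c) ^ k := by
      have := congrArg (taylor (-c)) hmon
      rw [taylor_taylor, neg_add_cancel, taylor_zero] at this
      rw [this]
      simp [taylor_mul, taylor_pow, sub_eq_add_neg]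
    generalize (taylor c p).coeff k = A at hp hlead
    have hc0 : c = 0 := by
      rw [hp, coeff_C_mul, coeff_X_sub_C_pow_pred c (by omega)] at hsub
      simpa [hlead, show k ≠ 0 by omega] using hsub
    rw [hp, hc0] at hi
    simp [coeff_X_pow, hik.ne] at hi

/-- **Newton–Puiseux**: a family of polynomials whose value at `t = 0` vanishes to order `k ≠ 0`
at the origin has a convergent Puiseux root through the origin. -/
theorem IsAnalyticFamily.exists_puiseux_root {n k : ℕ} {P : ℂ → ℂ[X]} (hP : IsAnalyticFamily n P)
    (hk : k ≠ 0) (h0 : ∀ i < k, (P 0).coeff i = 0) (hne : (P 0).coeff k ≠ 0) :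
    ∃ N : ℕ, N ≠ 0 ∧ ∃ ξ : ℂ → ℂ, AnalyticAt ℂ ξ 0 ∧ ξ 0 = 0 ∧
      ∀ᶠ t in 𝓝 0, (P (t ^ N)).eval (ξ t) = 0 := by
  induction k using Nat.strong_induction_on generalizing P with
  | _ k ih =>
  have hkn : k ≤ n := (le_natDegree_of_ne_zero hne).trans (hP.natDegree_le 0)
  obtain ⟨φ, hφ, hφ0, hφr⟩ := (hP.hasseDeriv (k - 1)).exists_root_of_simple
    (by simp [hasseDeriv_coeff, h0 (k - 1) (by omega)])
    (by
      rw [hasseDeriv_coeff, Nat.add_sub_cancel' (by omega : 1 ≤ k)]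
      exact mul_ne_zero (Nat.cast_ne_zero.2 (Nat.choose_pos (Nat.sub_le _ _)).ne') hne)
  have hP1 := hP.taylor hφ
  set P₁ : ℂ → ℂ[X] := fun t => Polynomial.taylor (φ t) (P t) with hP₁
  have hP10 : P₁ 0 = P 0 := by simp [hP₁, hφ0]
  by_cases hall : ∀ᶠ t in 𝓝 0, (P₁ t).coeff 0 = 0
  · refine ⟨1, one_ne_zero, φ, hφ, hφ0, ?_⟩
    filter_upwards [hall] with t ht
    simpa [hP₁] using ht
  obtain ⟨e, o, he, ho, g, hg, hag, i₀, hi₀, hgi₀⟩ :=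
    exists_newton_edge (k := k) (a := fun i t => (P₁ t).coeff i)
    (fun i _ => hP1.analyticAt_coeff i) (fun i hi => by simpa [hP10] using h0 i hi)
    ⟨0, Nat.pos_of_ne_zero hk, hall⟩
  set g' : ℕ → ℂ → ℂ := fun i s =>
    if i < k then g i s else (P₁ (s ^ e)).coeff i * s ^ (o * (i - k)) with hg'
  have hP2 : IsAnalyticFamily n (fun t => ∑ i ∈ Finset.range (n + 1), C (g' i t) * X ^ i) := by
    refine isAnalyticFamily_sum fun i _ => ?_
    by_cases hik : i < k
    · simpa only [hg', hik, if_true] using hg i hik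
    · simp only [hg', hik, if_false]
      exact ((hP1.comp_pow he).analyticAt_coeff i).mul (analyticAt_id.pow _)
  set P₂ : ℂ → ℂ[X] := fun t => ∑ i ∈ Finset.range (n + 1), C (g' i t) * X ^ i with hP₂
  have hcoeff : ∀ s j, (P₂ s).coeff j = if j ≤ n then g' j s else 0 :=
    fun s j => coeff_sum_range_C_mul_X_pow n (fun i => g' i s) j
  have hrel : ∀ᶠ s in 𝓝 0, ∀ x, (P₁ (s ^ e)).eval (s ^ o * x) = s ^ (o * k) * (P₂ s).eval x := by
    have : ∀ᶠ s in 𝓝 (0 : ℂ), ∀ i ∈ Finset.range k,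
        (P₁ (s ^ e)).coeff i = s ^ (o * (k - i)) * g i s :=
      (Finset.eventually_all _).2 fun i hi => hag i (Finset.mem_range.1 hi)
    filter_upwards [this] with s hs x
    rw [eval_eq_sum_range' (Nat.lt_succ_of_le (hP1.natDegree_le _)),
      eval_eq_sum_range' (Nat.lt_succ_of_le (hP2.natDegree_le _)), Finset.mul_sum]
    refine Finset.sum_congr rfl fun i hi => ?_
    rw [hcoeff, if_pos (Nat.lt_succ_iff.1 (Finset.mem_range.1 hi)), mul_pow, ← pow_mul]
    by_cases hik : i < k
    · simp only [hg', hik, if_true]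
      rw [hs i (Finset.mem_range.2 hik)]
      obtain ⟨d, rfl⟩ := Nat.exists_eq_add_of_lt hik
      rw [show i + d + 1 - i = d + 1 by omega]
      ring
    · simp only [hg', hik, if_false]
      obtain ⟨d, rfl⟩ := Nat.exists_eq_add_of_le (not_lt.1 hik)
      rw [show k + d - k = d by omega]
      ring
  have hdeg : (P₂ 0).natDegree = k := by
    refine natDegree_eq_of_le_of_coeff_ne_zero ?_ ?_
    · refine natDegree_le_iff_coeff_eq_zero.2 fun j hj => ?_
      rw [hcoeff]
      split_ifs
      · simp only [hg', not_lt.2 hj.le, if_false]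
        rw [zero_pow (mul_ne_zero ho (by omega)), mul_zero]
      · rfl
    · rw [hcoeff, if_pos hkn]
      simpa [hg', he, hP10] using hne
  have hsub : (P₂ 0).coeff (k - 1) = 0 := by
    have hk1 : k - 1 < k := by omega
    rw [hcoeff, if_pos (by omega)]
    simp only [hg', hk1, if_true]
    have hpow : Tendsto (fun s : ℂ => s ^ e) (𝓝 0) (𝓝 0) := by
      simpa [he] using (continuous_pow (M := ℂ) e).tendsto 0
    have hev : ∀ᶠ s in 𝓝[≠] (0 : ℂ), g (k - 1) s = 0 := by
      filter_upwards [(hag (k - 1) hk1).filter_mono nhdsWithin_le_nhds,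
        (hpow.eventually hφr).filter_mono nhdsWithin_le_nhds, self_mem_nhdsWithin] with s h1 h2 h3
      rw [← taylor_coeff] at h2
      rw [show (P₁ (s ^ e)).coeff (k - 1) = 0 from h2] at h1
      exact (mul_eq_zero.1 h1.symm).resolve_left (pow_ne_zero _ h3)
    exact tendsto_nhds_unique (((hg _ hk1).continuousAt.tendsto).mono_left nhdsWithin_le_nhds)
      (tendsto_const_nhds.congr' (hev.mono fun _ h => h.symm))
  obtain ⟨c, l, hl0, hlk, hlz, hl⟩ := exists_root_multiplicity_lt hdeg hsub hi₀ (by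
    rw [hcoeff, if_pos (by omega)]
    simpa [hg', hi₀] using hgi₀)
  obtain ⟨N, hN, ξ, hξ, hξ0, hroot⟩ := ih l hlk (hP2.taylor (analyticAt_const (v := c))) hl0 hlz hl
  have hpN : Tendsto (fun s : ℂ => s ^ N) (𝓝 0) (𝓝 0) := by
    simpa [hN] using (continuous_pow (M := ℂ) N).tendsto 0
  refine ⟨N * e, mul_ne_zero hN he, fun s => s ^ (N * o) * (ξ s + c) + φ (s ^ (N * e)), ?_, ?_, ?_⟩
  · refine ((analyticAt_id.pow _).mul (hξ.add analyticAt_const)).add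
      (AnalyticAt.fun_comp ?_ (analyticAt_id.pow (N * e)))
    simpa [hN, he] using hφ
  · simp [hN, he, ho, hφ0]
  · filter_upwards [hroot, hpN.eventually hrel] with s h1 h2
    have h3 := h2 (ξ s + c)
    rw [taylor_eval] at h1
    rw [h1, mul_zero, ← pow_mul, ← pow_mul, taylor_eval] at h3
    exact h3

/-- **Newton–Puiseux**, all roots: after ramification, every root of a Weierstrass polynomial lies
on one of finitely many analytic arcs. -/
theorem IsAnalyticFamily.exists_puiseux_roots {d : ℕ} {P : ℂ → ℂ[X]} (hP : IsAnalyticFamily d P)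
    (hmonic : ∀ t, (P t).Monic) (hdeg : ∀ t, (P t).natDegree = d) (h0 : P 0 = X ^ d) :
    ∃ N : ℕ, N ≠ 0 ∧ ∃ L : List (ℂ → ℂ),
      (∀ ξ ∈ L, AnalyticAt ℂ ξ 0 ∧ ξ 0 = 0 ∧ ∀ᶠ t in 𝓝 0, (P (t ^ N)).eval (ξ t) = 0) ∧
      ∀ᶠ t in 𝓝 0, ∀ x, (P (t ^ N)).eval x = 0 → ∃ ξ ∈ L, ξ t = x := by
  induction d generalizing P with
  | zero =>
    refine ⟨1, one_ne_zero, [], by simp, .of_forall fun t x hx => ?_⟩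
    rw [(hmonic _).natDegree_eq_zero.1 (hdeg _)] at hx
    simp at hx
  | succ d ih =>
    obtain ⟨N, hN, ξ, hξ, hξ0, hroot⟩ := hP.exists_puiseux_root (k := d + 1) (by omega)
      (fun i hi => by simp [h0, coeff_X_pow, hi.ne]) (by simp [h0])
    have hmul : ∀ᶠ t in 𝓝 0,
        (X - C (ξ t)) * (P (t ^ N) /ₘ (X - C (ξ t))) = P (t ^ N) :=
      hroot.mono fun t ht => mul_divByMonic_eq_iff_isRoot.2 ht
    have hQdeg : ∀ t, (P (t ^ N) /ₘ (X - C (ξ t))).natDegree = d := fun t => by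
      rw [natDegree_divByMonic _ (monic_X_sub_C _), hdeg, natDegree_X_sub_C, Nat.add_sub_cancel]
    have hQ : IsAnalyticFamily d (fun t => P (t ^ N) /ₘ (X - C (ξ t))) :=
      ⟨fun t => (hQdeg t).le, ((hP.comp_pow hN).divByMonic hξ).analyticAt_coeff⟩
    obtain ⟨M, hM, L, hL, hLx⟩ := ih hQ
      (fun t => by
        rw [Monic, leadingCoeff_divByMonic_X_sub_C, hmonic]
        rw [degree_eq_natDegree (hmonic _).ne_zero, hdeg]
        exact_mod_cast d.succ_ne_zero) hQdeg (by
          have := hmul.self_of_nhds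
          rw [zero_pow hN, h0, hξ0, C_0, sub_zero, pow_succ'] at this
          simpa [hN, hξ0, h0, pow_succ'] using mul_left_cancel₀ X_ne_zero this)
    have hpM : Tendsto (fun s : ℂ => s ^ M) (𝓝 0) (𝓝 0) := by
      simpa [hM] using (continuous_pow (M := ℂ) M).tendsto 0
    refine ⟨M * N, mul_ne_zero hM hN, (fun t => ξ (t ^ M)) :: L, ?_, ?_⟩
    · simp only [List.mem_cons, forall_eq_or_imp]
      refine ⟨⟨AnalyticAt.fun_comp (by simpa [hM] using hξ) (analyticAt_id.pow M),
        by simp [hM, hξ0], ?_⟩, fun η hη => ⟨(hL η hη).1, (hL η hη).2.1, ?_⟩⟩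
      · filter_upwards [hpM.eventually hroot] with t ht
        rwa [← pow_mul] at ht
      · filter_upwards [(hL η hη).2.2, hpM.eventually hmul] with t ht hm
        rw [pow_mul, ← hm, eval_mul, ht, mul_zero]
    · filter_upwards [hLx, hpM.eventually hmul] with t ht hm x hx
      rw [pow_mul, ← hm, eval_mul, mul_eq_zero] at hx
      rcases hx with hx | hx
      · exact ⟨_, List.mem_cons_self, by simpa [sub_eq_zero, eq_comm] using hx⟩
      · obtain ⟨η, hη, h⟩ := ht x hx
        exact ⟨η, List.mem_cons_of_mem _ hη, h⟩

/-- A monic complex polynomial all of whose critical points are roots is a power of a linear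
polynomial. -/
theorem Polynomial.Monic.eq_X_sub_C_pow_of_isRoot_derivative {p : ℂ[X]} {m : ℕ} (hp : p.Monic)
    (hm : m ≠ 0) (hdeg : p.natDegree = m) (h : ∀ x, p.derivative.eval x = 0 → p.eval x = 0) :
    p = (X - C (-p.coeff (m - 1) / m)) ^ m := by
  classical
  have hp' : p.derivative ≠ 0 := by
    rw [Ne, derivative_eq_zero, hdeg]
    simpa using hm
  have hsub : p.derivative.roots.toFinset ⊆ p.roots.toFinset := by
    intro x hx
    rw [Multiset.mem_toFinset, mem_roots hp'] at hx
    rw [Multiset.mem_toFinset, mem_roots hp.ne_zero]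
    exact h x hx
  have h1 : ∑ x ∈ p.roots.toFinset, p.roots.count x = m := by
    rw [Multiset.toFinset_sum_count_eq, ← hdeg]
    exact (splits_iff_card_roots.1 (IsAlgClosed.splits p))
  have h2 : ∑ x ∈ p.roots.toFinset, p.derivative.roots.count x = m - 1 := by
    rw [Multiset.sum_count_eq_card fun x hx => hsub (Multiset.mem_toFinset.2 hx),
      splits_iff_card_roots.1 (IsAlgClosed.splits _), natDegree_derivative, hdeg]
  have h3 : ∀ x ∈ p.roots.toFinset, p.roots.count x = p.derivative.roots.count x + 1 := by
    intro x hx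
    rw [Multiset.mem_toFinset] at hx
    have h4 := derivative_rootMultiplicity_of_root ((mem_roots hp.ne_zero).1 hx)
    have h5 := Multiset.count_pos.2 hx
    rw [count_roots] at h5 ⊢
    rw [count_roots]
    omega
  rw [Finset.sum_congr rfl h3, Finset.sum_add_distrib, h2] at h1
  simp only [Finset.sum_const, smul_eq_mul, mul_one] at h1
  obtain ⟨a, ha⟩ := Finset.card_eq_one.1 (show p.roots.toFinset.card = 1 by omega)
  have hrep : p.roots = Multiset.replicate m a := by
    refine Multiset.eq_replicate.2 ⟨?_, fun x hx => ?_⟩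
    · rw [← hdeg]
      exact splits_iff_card_roots.1 (IsAlgClosed.splits p)
    · simpa [ha] using Multiset.mem_toFinset.2 hx
  have hpa : p = (X - C a) ^ m := by
    have := (IsAlgClosed.splits p).eq_prod_roots_of_monic hp
    rw [hrep] at this
    simpa using this
  have hcoeff : p.coeff (m - 1) = -m * a := by
    rw [hpa, coeff_X_sub_C_pow_pred a hm]
  have hm' : (m : ℂ) ≠ 0 := Nat.cast_ne_zero.2 hm
  rw [hcoeff, show -(-(m : ℂ) * a) / m = a by field_simp]
  exact hpa

theorem LGE_eq_of_eventuallyEq_pow {m : ℕ} (hm : 1 ≤ m) {f : ℂ × ℂ → ℂ} {φ : ℂ → ℂ}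
    (hφ : AnalyticAt ℂ φ 0) (hφ0 : φ 0 = 0)
    (hf : ∀ᶠ p : ℂ × ℂ in 𝓝 0, f p = (p.1 - φ p.2) ^ m) :
    LGE f = ((m : ℝ) - 1) / m := by
  have hm0 : (0 : ℝ) < m := by exact_mod_cast hm
  have hm1 : (1 : ℝ) ≤ m := by exact_mod_cast hm
  set L : ℂ × ℂ → (ℂ × ℂ →L[ℂ] ℂ) := fun p =>
    ContinuousLinearMap.fst ℂ ℂ ℂ - deriv φ p.2 • ContinuousLinearMap.snd ℂ ℂ ℂ with hL
  have hsnd : Tendsto (Prod.snd : ℂ × ℂ → ℂ) (𝓝 0) (𝓝 0) := continuous_snd.tendsto 0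
  have hder : ∀ᶠ p : ℂ × ℂ in 𝓝 0,
      fderiv ℂ f p = ((m : ℂ) * (p.1 - φ p.2) ^ (m - 1)) • L p := by
    filter_upwards [hf.eventually_nhds, hsnd.eventually hφ.eventually_analyticAt] with p hp hφp
    have h1 : HasFDerivAt (fun q : ℂ × ℂ => φ q.2)
        (deriv φ p.2 • ContinuousLinearMap.snd ℂ ℂ ℂ) p :=
      hφp.differentiableAt.hasDerivAt.comp_hasFDerivAt p hasFDerivAt_snd
    have h2 := (hasFDerivAt_fst.sub h1).pow m
    have h3 : fderiv ℂ f p = fderiv ℂ (fun q : ℂ × ℂ => (q.1 - φ q.2) ^ m) p :=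
      Filter.EventuallyEq.fderiv_eq hp
    rw [h3]
    refine (HasFDerivAt.congr_fderiv (f := fun q : ℂ × ℂ => (q.1 - φ q.2) ^ m) h2 ?_).fderiv
    simp [hL]
  have hnorm : ∀ᶠ p : ℂ × ℂ in 𝓝 0,
      ‖f p‖ = ‖p.1 - φ p.2‖ ^ m ∧ ‖fderiv ℂ f p‖ = m * ‖p.1 - φ p.2‖ ^ (m - 1) * ‖L p‖ := by
    filter_upwards [hf, hder] with p h1 h2
    rw [h1, h2, norm_smul]
    simp
  have hone : ∀ p, 1 ≤ ‖L p‖ := fun p => by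
    have := (L p).le_opNorm (1, 0)
    simpa [hL, Prod.norm_def] using this
  have hmem : ∀ l : ℝ, 0 < l → ((m : ℝ) - 1) / m ≤ l → 0 < l ∧ ∃ c > (0:ℝ), ∃ ε > (0:ℝ),
      ∀ z : ℂ × ℂ, ‖z‖ < ε → c * ‖f z‖ ^ l ≤ ‖fderiv ℂ f z‖ := by
    intro l hl hml
    have hsmall : ∀ᶠ p : ℂ × ℂ in 𝓝 0, ‖p.1 - φ p.2‖ < 1 := by
      have hcont : ContinuousAt (fun p : ℂ × ℂ => ‖p.1 - φ p.2‖) 0 :=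
        (continuousAt_fst.sub (ContinuousAt.comp' (g := φ) hφ.continuousAt continuousAt_snd)).norm
      exact hcont.eventually_lt_const (by simp [hφ0])
    obtain ⟨ε, hε, h⟩ := Metric.eventually_nhds_iff.1 (hnorm.and hsmall)
    refine ⟨hl, 1, one_pos, ε, hε, fun z hz => ?_⟩
    obtain ⟨⟨h1, h2⟩, h3⟩ := h (y := z) (by simpa using hz)
    rw [h1, h2, one_mul]
    have hpow : (‖z.1 - φ z.2‖ ^ m) ^ l ≤ ‖z.1 - φ z.2‖ ^ (m - 1) := by
      rcases (norm_nonneg (z.1 - φ z.2)).eq_or_lt with hu | hu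
      · rw [← hu, zero_pow (by omega), Real.zero_rpow hl.ne']
        positivity
      · rw [← Real.rpow_natCast, ← Real.rpow_natCast, ← Real.rpow_mul hu.le, Nat.cast_sub hm,
          Nat.cast_one]
        refine Real.rpow_le_rpow_of_exponent_ge hu h3.le ?_
        rwa [mul_comm, ← div_le_iff₀ hm0]
    calc (‖z.1 - φ z.2‖ ^ m) ^ l ≤ 1 * ‖z.1 - φ z.2‖ ^ (m - 1) * 1 := by simpa using hpow
      _ ≤ m * ‖z.1 - φ z.2‖ ^ (m - 1) * ‖L z‖ := by gcongr; exact hone z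
  refine csInf_eq_of_forall_ge_of_forall_gt_exists_lt ⟨1, hmem 1 one_pos ?_⟩ ?_ ?_
  · rw [div_le_one hm0]
    linarith
  · rintro l ⟨hl, c, hc, ε, hε, h⟩
    by_contra! hlt
    rw [lt_div_iff₀ hm0] at hlt
    have hδ : 0 < (m : ℝ) - 1 - l * m := by linarith
    have hray : Tendsto (fun r : ℝ => (((r : ℂ), (0 : ℂ)) : ℂ × ℂ)) (𝓝[>] 0) (𝓝 0) := by
      have : Continuous (fun r : ℝ => (((r : ℂ), (0 : ℂ)) : ℂ × ℂ)) := by fun_prop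
      exact (this.tendsto' 0 0 (by simp)).mono_left nhdsWithin_le_nhds
    have hball : ∀ᶠ z : ℂ × ℂ in 𝓝 0, ‖z‖ < ε :=
      continuous_norm.continuousAt.eventually_lt_const (by simpa using hε)
    have hbound : ∀ᶠ r : ℝ in 𝓝[>] 0, c ≤ m * ‖L 0‖ * r ^ ((m : ℝ) - 1 - l * m) := by
      filter_upwards [hray.eventually (hnorm.and hball), self_mem_nhdsWithin] with r hr hr0
      have hr0 : 0 < r := hr0
      obtain ⟨⟨h1, h2⟩, h3⟩ := hr
      have h4 := h _ h3
      have hLr : L ((r : ℂ), 0) = L 0 := by simp [hL]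
      rw [h1, h2, hLr] at h4
      simp only [hφ0, sub_zero, Complex.norm_real, Real.norm_eq_abs, abs_of_pos hr0] at h4
      rw [← Real.rpow_natCast, ← Real.rpow_natCast, ← Real.rpow_mul hr0.le, Nat.cast_sub hm,
        Nat.cast_one, mul_comm (m : ℝ) l] at h4
      rw [Real.rpow_sub hr0, ← mul_div_assoc, le_div_iff₀ (Real.rpow_pos_of_pos hr0 _)]
      linarith
    have hlim : Tendsto (fun r : ℝ => m * ‖L 0‖ * r ^ ((m : ℝ) - 1 - l * m)) (𝓝[>] 0) (𝓝 0) := by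
      have := (Real.continuousAt_rpow_const 0 _ (Or.inr hδ.le)).tendsto
      rw [Real.zero_rpow hδ.ne'] at this
      simpa using (this.mono_left nhdsWithin_le_nhds).const_mul (m * ‖L 0‖)
    exact absurd (ge_of_tendsto hlim hbound) (not_le.2 hc)
  · intro w hw
    have h0 : 0 ≤ ((m : ℝ) - 1) / m := div_nonneg (by linarith) hm0.le
    exact ⟨(((m : ℝ) - 1) / m + w) / 2, hmem _ (by linarith) (by linarith), by linarith⟩

/-- a Weierstrass polynomial `f(x,y) = x^m + a₁(y)x^{m-1} + ⋯ + a_m(y)` all of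
whose polar (Newton–Puiseux) roots of `∂f/∂x = 0` are roots of `f = 0` is of the form
`(x - φ(y))^m`, and `ℒ(f) = (m-1)/m`. Puiseux series are encoded by analytic arcs
`t ↦ (ξ(t), t^N)`. -/
theorem stmt3 (m : ℕ) (hm : 1 ≤ m) (b : ℕ → ℂ → ℂ)
    (hb : ∀ i ≤ m, AnalyticAt ℂ (b i) 0) (hbm : ∀ y, b m y = 1)
    (hb0 : ∀ i < m, b i 0 = 0)
    (f : ℂ × ℂ → ℂ)
    (hf : ∀ p : ℂ × ℂ, f p = ∑ i ∈ Finset.range (m + 1), b i p.2 * p.1 ^ i)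
    (hroots : ∀ N : ℕ, 1 ≤ N → ∀ ξ : ℂ → ℂ, AnalyticAt ℂ ξ 0 → ξ 0 = 0 →
      (∀ᶠ t in nhds (0 : ℂ), deriv (fun x => f (x, t ^ N)) (ξ t) = 0) →
      (∀ᶠ t in nhds (0 : ℂ), f (ξ t, t ^ N) = 0)) :
    ∃ φ : ℂ → ℂ, AnalyticAt ℂ φ 0 ∧ φ 0 = 0 ∧
      (∀ᶠ p : ℂ × ℂ in nhds 0, f p = (p.1 - φ p.2) ^ m) ∧
      LGE f = ((m : ℝ) - 1) / m := by
  have hm0 : (m : ℂ) ≠ 0 := Nat.cast_ne_zero.2 (by omega)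
  have hF := isAnalyticFamily_sum hb
  set F : ℂ → ℂ[X] := fun y => ∑ i ∈ Finset.range (m + 1), C (b i y) * X ^ i with hFdef
  have hcoeff : ∀ y j, (F y).coeff j = if j ≤ m then b j y else 0 :=
    fun y j => coeff_sum_range_C_mul_X_pow m (fun i => b i y) j
  have hFm : ∀ y, (F y).coeff m = 1 := fun y => by rw [hcoeff, if_pos le_rfl, hbm]
  have hdeg : ∀ y, (F y).natDegree = m := fun y =>
    natDegree_eq_of_le_of_coeff_ne_zero (hF.natDegree_le y) (by simp [hFm])
  have hmonic : ∀ y, (F y).Monic := fun y => by rw [Monic, leadingCoeff, hdeg, hFm]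
  have hfF : ∀ x y, f (x, y) = (F y).eval x := fun x y => by
    simp [hf, hFdef, eval_finsetSum]
  have hF0 : F 0 = X ^ m := by
    ext j
    rw [hcoeff, coeff_X_pow]
    rcases lt_trichotomy j m with h | rfl | h
    · rw [if_pos h.le, if_neg h.ne, hb0 j h]
    · simp [hbm]
    · rw [if_neg (not_le.2 h), if_neg h.ne']
  set P : ℂ → ℂ[X] := fun y => C ((m : ℂ)⁻¹) * derivative (F y) with hPdef
  have hPdeg : ∀ y, (P y).natDegree = m - 1 := fun y => by
    rw [hPdef, natDegree_C_mul (inv_ne_zero hm0), natDegree_derivative, hdeg]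
  have hPmonic : ∀ y, (P y).Monic := fun y => by
    rw [Monic, leadingCoeff, hPdeg, hPdef, coeff_C_mul, coeff_derivative,
      Nat.sub_add_cancel hm, hFm, Nat.cast_sub hm]
    simp [hm0]
  have hP : IsAnalyticFamily (m - 1) P := by
    refine ⟨fun y => (hPdeg y).le, fun i => ?_⟩
    simp only [hPdef, coeff_C_mul, coeff_derivative]
    exact analyticAt_const.mul ((hF.analyticAt_coeff _).mul analyticAt_const)
  have hP0 : P 0 = X ^ (m - 1) := by
    rw [hPdef]
    simp only [hF0, derivative_X_pow]
    rw [← mul_assoc, ← C_mul, inv_mul_cancel₀ hm0, C_1, one_mul]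
  have hProot : ∀ x y, (P y).eval x = 0 ↔ (derivative (F y)).eval x = 0 := fun x y => by
    simp [hPdef, hm0]
  obtain ⟨N, hN, Λ, hΛ, hall⟩ := hP.exists_puiseux_roots hPmonic hPdeg hP0
  have hΛf : ∀ᶠ t in 𝓝 (0 : ℂ), ∀ ξ ∈ Λ, (F (t ^ N)).eval (ξ t) = 0 := by
    have : ∀ᶠ t in 𝓝 (0 : ℂ), ∀ ξ ∈ {ξ | ξ ∈ Λ}, (F (t ^ N)).eval (ξ t) = 0 := by
      refine (Set.Finite.eventually_all Λ.finite_toSet).2 fun ξ hξ => ?_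
      obtain ⟨h1, h2, h3⟩ := hΛ ξ hξ
      refine (hroots N (by omega) ξ h1 h2 ?_).mono fun t ht => by rwa [← hfF]
      filter_upwards [h3] with t ht
      simp only [hfF, Polynomial.deriv]
      exact (hProot _ _).1 ht
    exact this
  have hmain : ∀ᶠ t in 𝓝 (0 : ℂ), F (t ^ N) = (X - C (-(b (m - 1) (t ^ N)) / m)) ^ m := by
    filter_upwards [hall, hΛf] with t h1 h2
    have := (hmonic (t ^ N)).eq_X_sub_C_pow_of_isRoot_derivative (by omega) (hdeg _) fun x hx => by
      obtain ⟨ξ, hξ, rfl⟩ := h1 x ((hProot _ _).2 hx)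
      exact h2 ξ hξ
    rwa [hcoeff, if_pos (by omega)] at this
  have hF' : ∀ᶠ y in 𝓝 (0 : ℂ), F y = (X - C (-(b (m - 1) y) / m)) ^ m := by
    obtain ⟨ε, hε, h⟩ := Metric.eventually_nhds_iff.1 hmain
    refine Metric.eventually_nhds_iff.2 ⟨ε ^ N, pow_pos hε N, fun y hy => ?_⟩
    obtain ⟨t, rfl⟩ := IsAlgClosed.exists_pow_nat_eq y (Nat.pos_of_ne_zero hN)
    refine h ?_
    rw [dist_zero_right, norm_pow] at hy
    rw [dist_zero_right]
    exact lt_of_pow_lt_pow_left₀ N hε.le hy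
  have hφ : AnalyticAt ℂ (fun y => -(b (m - 1) y) / m) 0 :=
    (hb _ (by omega)).neg.div analyticAt_const hm0
  have hφ0 : -(b (m - 1) 0) / (m : ℂ) = 0 := by simp [hb0 (m - 1) (by omega)]
  have hfeq : ∀ᶠ p : ℂ × ℂ in 𝓝 0, f p = (p.1 - -(b (m - 1) p.2) / m) ^ m := by
    filter_upwards [(continuous_snd.tendsto (0 : ℂ × ℂ)).eventually hF'] with p hp
    rw [← Prod.mk.eta (p := p), hfF, hp]
    simp
  exact ⟨_, hφ, hφ0, hfeq, LGE_eq_of_eventuallyEq_pow hm hφ hφ0 hfeq⟩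
end
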